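/- arXiv:1103.1018 — 9 statements merged into one kernel-verified Lean document; each statement's English description precedes it below -/
import Mathlib

section
/- Let R be a commutative ring and let e_1,…,e_k be pairwise orthogonal idempotents of R with e_1 + … + e_k = 1. Two systems (A,B) and (A',B') of size (n,m) over R are feedback equivalent over R if and only if, for every i, the systems (e_i·A, e_i·B) and (e_i·A', e_i·B') are feedback equivalent over the ring e_iR (equivalently, the images of the systems in R/(1−e_i)R are feedback equivalent). -/
open Matrix

/-- Feedback equivalence of linear systems `(A, B)` and `(A', B')`:
`A' = P(A + BK)P⁻¹` and `B' = PBQ` for some invertible `P`, `Q` and some `K`. -/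
def FeedbackEquiv {n m : Type*} [Fintype n] [DecidableEq n] [Fintype m] [DecidableEq m]
    (R : Type*) [CommRing R]
    (A : Matrix n n R) (B : Matrix n m R)
    (A' : Matrix n n R) (B' : Matrix n m R) : Prop :=
  ∃ (P : GL n R) (Q : GL m R) (K : Matrix m n R),
    A' = (P : Matrix n n R) * (A + B * K) * ((P⁻¹ : GL n R) : Matrix n n R) ∧
    B' = (P : Matrix n n R) * B * (Q : Matrix m m R)

section Components

variable {R : Type*} [CommRing R]

/-- Feedback equivalence is preserved by ring homomorphisms. -/
theorem FeedbackEquiv.map {n m : Type*} [Fintype n] [DecidableEq n] [Fintype m] [DecidableEq m]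
    {S : Type*} [CommRing S] (f : R →+* S)
    {A A' : Matrix n n R} {B B' : Matrix n m R} (h : FeedbackEquiv R A B A' B') :
    FeedbackEquiv S (A.map f) (B.map f) (A'.map f) (B'.map f) := by
  obtain ⟨P, Q, K, rfl, rfl⟩ := h
  refine ⟨Units.map f.mapMatrix.toMonoidHom P, Units.map f.mapMatrix.toMonoidHom Q,
    K.map f, ?_, ?_⟩
  · rw [← map_inv]
    simp [Matrix.map_mul, Matrix.map_add]
  · simp [Matrix.map_mul]

variable {ι : Type*} {S : ι → Type*} [∀ i, CommRing (S i)] {f : ∀ i, R →+* S i}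

/-- Matrices over a ring that embeds in a product are equal if all their components are. -/
theorem Matrix.ext_of_injective_pi {m n : Type*} (hf : Function.Injective (RingHom.pi f))
    {M N : Matrix m n R} (h : ∀ i, M.map (f i) = N.map (f i)) : M = N := by
  ext a b
  exact hf (funext fun i ↦ congrFun₂ (h i) a b)

/-- A family of matrices over the components of a product ring comes from a matrix over it. -/
theorem Matrix.exists_map_eq_of_surjective_pi {m n : Type*}
    (hf : Function.Surjective (RingHom.pi f)) (M : ∀ i, Matrix m n (S i)) :
    ∃ N : Matrix m n R, ∀ i, N.map (f i) = M i := by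
  choose N hN using fun a b ↦ hf fun i ↦ M i a b
  exact ⟨Matrix.of N, fun i ↦ Matrix.ext fun a b ↦ congrFun (hN a b) i⟩

/-- A family of invertible matrices over the components of a product ring comes from an
invertible matrix over it. -/
theorem Matrix.GeneralLinearGroup.exists_map_eq_of_bijective_pi {n : Type*} [Fintype n]
    [DecidableEq n] (hf : Function.Bijective (RingHom.pi f)) (P : ∀ i, GL n (S i)) :
    ∃ U : GL n R, ∀ i, (U : Matrix n n R).map (f i) = P i ∧
      ((U⁻¹ : GL n R) : Matrix n n R).map (f i) = ((P i)⁻¹ : GL n (S i)) := by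
  obtain ⟨U, hU⟩ := exists_map_eq_of_surjective_pi hf.2 fun i ↦ (P i : Matrix n n (S i))
  obtain ⟨V, hV⟩ := exists_map_eq_of_surjective_pi hf.2
    fun i ↦ (((P i)⁻¹ : GL n (S i)) : Matrix n n (S i))
  refine ⟨⟨U, V, ext_of_injective_pi hf.1 fun i ↦ ?_, ext_of_injective_pi hf.1 fun i ↦ ?_⟩,
    fun i ↦ ⟨hU i, hV i⟩⟩
  · rw [Matrix.map_mul, hU, hV, Units.mul_inv, Matrix.map_one _ (map_zero _) (map_one _)]
  · rw [Matrix.map_mul, hU, hV, Units.inv_mul, Matrix.map_one _ (map_zero _) (map_one _)]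

/-- Over a product ring, feedback equivalence can be checked on the components. -/
theorem feedbackEquiv_iff_forall_map_of_bijective_pi {n m : Type*} [Fintype n] [DecidableEq n]
    [Fintype m] [DecidableEq m] (hf : Function.Bijective (RingHom.pi f))
    {A A' : Matrix n n R} {B B' : Matrix n m R} :
    FeedbackEquiv R A B A' B' ↔
      ∀ i, FeedbackEquiv (S i) (A.map (f i)) (B.map (f i)) (A'.map (f i)) (B'.map (f i)) := by
  refine ⟨fun h i ↦ h.map (f i), fun h ↦ ?_⟩
  choose P Q K hA hB using h
  obtain ⟨P', hP⟩ := Matrix.GeneralLinearGroup.exists_map_eq_of_bijective_pi hf P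
  obtain ⟨Q', hQ⟩ := Matrix.GeneralLinearGroup.exists_map_eq_of_bijective_pi hf Q
  obtain ⟨K', hK⟩ := Matrix.exists_map_eq_of_surjective_pi hf.2 K
  refine ⟨P', Q', K', Matrix.ext_of_injective_pi hf.1 fun i ↦ ?_,
    Matrix.ext_of_injective_pi hf.1 fun i ↦ ?_⟩
  · rw [hA, Matrix.map_mul, Matrix.map_mul, Matrix.map_add _ (map_add _), Matrix.map_mul,
      (hP i).1, (hP i).2, hK]
  · rw [hB, Matrix.map_mul, Matrix.map_mul, (hP i).1, (hQ i).1]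

end Components

/-- over a commutative ring with a complete family of pairwise
orthogonal idempotents `e i`, two systems `(A, B)` and `(A', B')` are feedback
equivalent over `R` iff for every `i` their images in the ring
`R ⧸ (1 - e i)R` (canonically isomorphic to `e iR`) are feedback equivalent. -/
theorem feedbackEquiv_iff_feedbackEquiv_components
    {R : Type*} [CommRing R] {k n m : ℕ}
    (e : Fin k → R)
    (hidem : ∀ i, IsIdempotentElem (e i))
    (horth : ∀ i j, i ≠ j → e i * e j = 0)
    (hsum : ∑ i, e i = 1)
    (A A' : Matrix (Fin n) (Fin n) R) (B B' : Matrix (Fin n) (Fin m) R) :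
    FeedbackEquiv R A B A' B' ↔
      ∀ i : Fin k,
        FeedbackEquiv (R ⧸ Ideal.span {1 - e i})
          (A.map (Ideal.Quotient.mk (Ideal.span {1 - e i})))
          (B.map (Ideal.Quotient.mk (Ideal.span {1 - e i})))
          (A'.map (Ideal.Quotient.mk (Ideal.span {1 - e i})))
          (B'.map (Ideal.Quotient.mk (Ideal.span {1 - e i}))) := by
  have he : CompleteOrthogonalIdempotents e := ⟨⟨hidem, fun i j hij ↦ horth i j hij⟩, hsum⟩
  exact feedbackEquiv_iff_forall_map_of_bijective_pi he.bijective_pi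
end

section
/- Let R be a commutative ring, let 0 < m < n, and consider systems of size (n,m) of the block form A = [[0, 0],[B_1, A_1]], B = [[I_m],[0]], where I_m ∈ R^{m×m} is the identity, A_1 ∈ R^{(n−m)×(n−m)} and B_1 ∈ R^{(n−m)×m}. Then two such systems, built from (A_1,B_1) and from (A'_1,B'_1) respectively, are feedback equivalent over R if and only if the systems (A_1,B_1) and (A'_1,B'_1) of size (n−m, m) are feedback equivalent over R. -/
open Matrix

/-- Feedback equivalence with the similarity relation cleared of inverses. -/
theorem feedbackEquiv_iff_mul_eq_mul {n m R : Type*} [Fintype n] [DecidableEq n] [Fintype m]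
    [DecidableEq m] [CommRing R] {A A' : Matrix n n R} {B B' : Matrix n m R} :
    FeedbackEquiv R A B A' B' ↔ ∃ (P : GL n R) (Q : GL m R) (K : Matrix m n R),
      A' * (P : Matrix n n R) = (P : Matrix n n R) * (A + B * K) ∧
      B' = (P : Matrix n n R) * B * (Q : Matrix m m R) := by
  unfold FeedbackEquiv
  simp only [Units.eq_mul_inv_iff_mul_eq]

/-- Block reduction for arbitrary finite index types. -/
theorem feedbackEquiv_fromBlocks_iff {m p R : Type*} [Fintype m] [DecidableEq m] [Fintype p]
    [DecidableEq p] [CommRing R] {A A' : Matrix p p R} {B B' : Matrix p m R} :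
    FeedbackEquiv R (fromBlocks 0 0 B A) (fromRows (1 : Matrix m m R) 0)
        (fromBlocks 0 0 B' A') (fromRows (1 : Matrix m m R) 0) ↔
      FeedbackEquiv R A B A' B' := by
  simp only [feedbackEquiv_iff_mul_eq_mul]
  constructor
  · rintro ⟨P, Q, K, hA, hB⟩
    obtain ⟨P₁₁, P₁₂, P₂₁, P₂₂, hP⟩ : ∃ P₁₁ P₁₂ P₂₁ P₂₂,
        (P : Matrix (m ⊕ p) (m ⊕ p) R) = fromBlocks P₁₁ P₁₂ P₂₁ P₂₂ :=
      ⟨_, _, _, _, (fromBlocks_toBlocks _).symm⟩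
    obtain ⟨X₁₁, X₁₂, X₂₁, X₂₂, hX⟩ : ∃ X₁₁ X₁₂ X₂₁ X₂₂,
        ((P⁻¹ : GL (m ⊕ p) R) : Matrix (m ⊕ p) (m ⊕ p) R) = fromBlocks X₁₁ X₁₂ X₂₁ X₂₂ :=
      ⟨_, _, _, _, (fromBlocks_toBlocks _).symm⟩
    obtain ⟨K₁, K₂, rfl⟩ : ∃ K₁ K₂, K = fromCols K₁ K₂ := ⟨_, _, (fromCols_toCols K).symm⟩
    have hPX := P.mul_inv
    rw [hP, hX, fromBlocks_multiply, ← fromBlocks_one, fromBlocks_inj] at hPX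
    rw [hP, fromBlocks_mul_fromRows, fromRows_mul, fromRows_inj.eq_iff] at hB
    simp only [Matrix.mul_one, Matrix.mul_zero, add_zero] at hB
    obtain ⟨h₁₁, h₂₁⟩ := hB
    obtain rfl : P₂₁ = 0 := by
      rw [← Matrix.mul_one P₂₁, ← Q.mul_inv, ← Matrix.mul_assoc, ← h₂₁, Matrix.zero_mul]
    have h₂₂ : P₂₂ * X₂₂ = 1 := by simpa using hPX.2.2.2
    rw [hP, fromRows_mul_fromCols, fromBlocks_add, fromBlocks_multiply, fromBlocks_multiply,
      fromBlocks_inj] at hA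
    simp only [Matrix.zero_mul, Matrix.mul_zero, add_zero, zero_add] at hA
    obtain ⟨-, -, hB', hA'⟩ := hA
    have hB'' : B' = P₂₂ * B * (Q : Matrix m m R) := by
      rw [← hB', Matrix.mul_assoc, ← h₁₁, Matrix.mul_one]
    refine ⟨⟨P₂₂, X₂₂, h₂₂, mul_eq_one_comm.mp h₂₂⟩, Q, -((Q : Matrix m m R) * P₁₂), ?_, hB''⟩
    simp only [Matrix.mul_add, Matrix.mul_neg, ← Matrix.mul_assoc, ← hA', ← hB'']
    abel
  · rintro ⟨P, Q, K, hA, hB⟩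
    let T : Matrix (m ⊕ p) (m ⊕ p) R :=
      fromBlocks ((Q⁻¹ : GL m R) : Matrix m m R) (-(((Q⁻¹ : GL m R) : Matrix m m R) * K)) 0 P
    let S : Matrix (m ⊕ p) (m ⊕ p) R :=
      fromBlocks Q (K * ((P⁻¹ : GL p R) : Matrix p p R)) 0 ((P⁻¹ : GL p R) : Matrix p p R)
    have hTS : T * S = 1 := by
      simp only [T, S, fromBlocks_multiply, ← fromBlocks_one, Units.inv_mul,
        Units.mul_inv, Matrix.mul_zero, Matrix.zero_mul, add_zero, zero_add, Matrix.neg_mul,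
        Matrix.mul_assoc, add_neg_cancel]
    refine ⟨⟨T, S, hTS, mul_eq_one_comm.mp hTS⟩, Q, fromCols (K * B) (K * A), ?_, ?_⟩
    · have hB' : B' * ((Q⁻¹ : GL m R) : Matrix m m R) = (P : Matrix p p R) * B := by
        rw [hB, Matrix.mul_assoc, Q.mul_inv, Matrix.mul_one]
      simp only [T, fromRows_mul_fromCols, fromBlocks_add, fromBlocks_multiply, fromBlocks_inj]
      simp only [Matrix.zero_mul, Matrix.mul_zero, add_zero, zero_add, Matrix.one_mul,
        Matrix.neg_mul, Matrix.mul_neg, ← Matrix.mul_assoc, add_neg_cancel, hB', hA,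
        Matrix.mul_add]
      refine ⟨trivial, by abel, trivial, by abel⟩
    · simp [T, fromBlocks_mul_fromRows, fromRows_mul]

/-- for systems of the block form `A = [[0,0],[B₁,A₁]]`,
`B = [[I],[0]]` with `0 < m < n`, feedback equivalence of the big systems is
equivalent to feedback equivalence of the small systems `(A₁, B₁)`, `(A₁', B₁')`. -/
theorem feedbackEquiv_block_reduction
    {R : Type*} [CommRing R] {n m : ℕ} (hm : 0 < m) (hmn : m < n)
    (A₁ A₁' : Matrix (Fin (n - m)) (Fin (n - m)) R)
    (B₁ B₁' : Matrix (Fin (n - m)) (Fin m) R) :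
    FeedbackEquiv R
        (Matrix.fromBlocks 0 0 B₁ A₁)
        (Matrix.fromRows (1 : Matrix (Fin m) (Fin m) R) 0)
        (Matrix.fromBlocks 0 0 B₁' A₁')
        (Matrix.fromRows (1 : Matrix (Fin m) (Fin m) R) 0) ↔
      FeedbackEquiv R A₁ B₁ A₁' B₁' := by
  exact feedbackEquiv_fromBlocks_iff
end

section
/- Let R be a commutative von Neumann regular ring, let 0 < p < n and p ≤ m, and consider systems of size (n,m) of the block form A = [[0, 0],[B_1, A_1]], B = [[I_p, 0],[0, 0]], where I_p ∈ R^{p×p} is the identity (so B has m−p additional zero columns), A_1 ∈ R^{(n−p)×(n−p)} and B_1 ∈ R^{(n−p)×p}. Then two such systems, built from (A_1,B_1) and from (A'_1,B'_1) respectively, are feedback equivalent over R if and only if the systems (A_1,B_1) and (A'_1,B'_1) of size (n−p, p) are feedback equivalent over R. -/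
open Matrix

theorem feedbackEquiv_iff_mul_eq {n m R : Type*} [Fintype n] [DecidableEq n] [Fintype m]
    [DecidableEq m] [CommRing R] (A A' : Matrix n n R) (B B' : Matrix n m R) :
    FeedbackEquiv R A B A' B' ↔ ∃ (P : GL n R) (Q : GL m R) (K : Matrix m n R),
      A' * (P : Matrix n n R) = (P : Matrix n n R) * (A + B * K) ∧
      B' = (P : Matrix n n R) * B * (Q : Matrix m m R) := by
  simp only [FeedbackEquiv, Units.eq_mul_inv_iff_mul_eq]

section BlockReduction

variable {R p q r : Type*} [CommRing R] [Fintype p] [DecidableEq p] [Fintype q] [DecidableEq q]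
  [Fintype r] [DecidableEq r]

/-- An upper block triangular invertible matrix whose inverse has diagonal blocks `Q` and `P⁻¹`. -/
def blockTriangularGL (Q : GL p R) (P : GL q R) (K : Matrix p q R) : GL (p ⊕ q) R where
  val := fromBlocks (Q⁻¹ : GL p R).val (-((Q⁻¹ : GL p R).val * K)) 0 P.val
  inv := fromBlocks Q.val (K * (P⁻¹ : GL q R).val) 0 (P⁻¹ : GL q R).val
  val_inv := by
    rw [fromBlocks_multiply, ← fromBlocks_one]
    simp only [Matrix.mul_zero, Matrix.zero_mul, add_zero, zero_add, Matrix.neg_mul,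
      Matrix.mul_assoc, add_neg_cancel, Units.inv_mul, Units.mul_inv]
  inv_val := by
    rw [fromBlocks_multiply, ← fromBlocks_one]
    simp only [Matrix.mul_zero, Matrix.zero_mul, add_zero, Matrix.mul_neg,
      Matrix.mul_assoc, Units.inv_mul, Units.mul_inv, Matrix.mul_one]
    simp only [← Matrix.mul_assoc, Units.mul_inv, Matrix.one_mul, neg_add_cancel, neg_zero, zero_add]

theorem FeedbackEquiv.fromBlocks {A A' : Matrix q q R} {B B' : Matrix q p R}
    (h : FeedbackEquiv R A B A' B') :
    FeedbackEquiv R (Matrix.fromBlocks 0 0 B A)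
      (Matrix.fromBlocks (1 : Matrix p p R) 0 0 (0 : Matrix q r R))
      (Matrix.fromBlocks 0 0 B' A')
      (Matrix.fromBlocks (1 : Matrix p p R) 0 0 (0 : Matrix q r R)) := by
  rw [feedbackEquiv_iff_mul_eq] at h ⊢
  obtain ⟨P, Q, K, hA, rfl⟩ := h
  refine ⟨blockTriangularGL Q P K,
    ⟨Matrix.fromBlocks Q.val 0 0 1, Matrix.fromBlocks (Q⁻¹ : GL p R).val 0 0 1, ?_, ?_⟩,
    Matrix.fromBlocks (K * B) (K * A) 0 0, ?_, ?_⟩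
  · simp only [fromBlocks_multiply, ← fromBlocks_one, Matrix.mul_zero, Matrix.zero_mul, add_zero,
      zero_add, Units.mul_inv, Matrix.mul_one]
  · simp only [fromBlocks_multiply, ← fromBlocks_one, Matrix.mul_zero, Matrix.zero_mul, add_zero,
      zero_add, Units.inv_mul, Matrix.mul_one]
  · simp only [blockTriangularGL, fromBlocks_multiply, fromBlocks_add, Matrix.mul_zero,
      Matrix.zero_mul, add_zero, zero_add, Matrix.one_mul, Matrix.neg_mul, neg_zero, Matrix.mul_neg,
      Matrix.mul_assoc, add_neg_cancel, Units.mul_inv, Matrix.mul_one, hA]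
    congr 1
    rw [← Matrix.mul_assoc Q.val, Units.mul_inv, Matrix.one_mul, Matrix.mul_add]
    abel
  · simp only [blockTriangularGL, fromBlocks_multiply, Matrix.mul_zero, Matrix.zero_mul, add_zero,
      Matrix.mul_one, Units.inv_mul]

theorem FeedbackEquiv.of_fromBlocks {A A' : Matrix q q R} {B B' : Matrix q p R}
    (h : FeedbackEquiv R (Matrix.fromBlocks 0 0 B A)
      (Matrix.fromBlocks (1 : Matrix p p R) 0 0 (0 : Matrix q r R))
      (Matrix.fromBlocks 0 0 B' A')
      (Matrix.fromBlocks (1 : Matrix p p R) 0 0 (0 : Matrix q r R))) :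
    FeedbackEquiv R A B A' B' := by
  rw [feedbackEquiv_iff_mul_eq] at h ⊢
  obtain ⟨P, Q, K, hA, hB⟩ := h
  have hP := P.mul_inv
  generalize (P⁻¹ : GL (p ⊕ q) R).val = S at hP
  generalize P.val = P at hA hB hP
  generalize Q.val = Q at hB
  rw [← fromBlocks_toBlocks P] at hA hB hP
  rw [← fromBlocks_toBlocks Q] at hB
  rw [← fromBlocks_toBlocks K] at hA
  rw [← fromBlocks_toBlocks S] at hP
  generalize P.toBlocks₁₁ = P₁₁ at *
  generalize P.toBlocks₁₂ = P₁₂ at *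
  generalize P.toBlocks₂₁ = P₂₁ at *
  generalize P.toBlocks₂₂ = P₂₂ at *
  generalize Q.toBlocks₁₁ = Q₁₁ at *
  simp only [fromBlocks_multiply, fromBlocks_add, ← fromBlocks_one, Matrix.mul_zero,
    Matrix.zero_mul, add_zero, zero_add, Matrix.one_mul, Matrix.mul_one, fromBlocks_inj]
    at hA hB hP
  obtain ⟨-, -, hA₂₁, hA₂₂⟩ := hA
  obtain ⟨hPQ, -, hPQ₂₁, -⟩ := hB
  obtain ⟨-, -, -, hPS⟩ := hP
  have hQP : Q₁₁ * P₁₁ = 1 := mul_eq_one_comm.mp hPQ.symm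
  have hP₂₁ : P₂₁ = 0 := by
    rw [← Matrix.mul_one P₂₁, ← hQP, ← Matrix.mul_assoc, ← hPQ₂₁, Matrix.zero_mul]
  subst hP₂₁
  simp only [Matrix.zero_mul, Matrix.mul_zero, add_zero, zero_add] at hA₂₁ hA₂₂ hPS
  have hB' : B' = P₂₂ * B * Q₁₁ := by
    rw [← hA₂₁, Matrix.mul_assoc, ← hPQ, Matrix.mul_one]
  refine ⟨⟨P₂₂, S.toBlocks₂₂, hPS, mul_eq_one_comm.mp hPS⟩, ⟨Q₁₁, P₁₁, hQP, hPQ.symm⟩,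
    -(Q₁₁ * P₁₂), ?_, hB'⟩
  rw [Matrix.mul_add, ← hA₂₂, hB']
  simp only [Matrix.mul_neg, Matrix.mul_assoc]
  abel

end BlockReduction

/-- over a commutative von Neumann regular ring, for systems of the
block form `A = [[0,0],[B₁,A₁]]`, `B = [[I_p, 0],[0,0]]` (so `B` may have `m - p`
additional zero columns), feedback equivalence of the big systems is equivalent
to feedback equivalence of the small systems `(A₁, B₁)`, `(A₁', B₁')`. -/
theorem feedbackEquiv_block_reduction_zero_columns
    {R : Type*} [CommRing R]
    (hreg : ∀ a : R, ∃ x : R, a ^ 2 * x = a)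
    {n m p : ℕ} (hp : 0 < p) (hpn : p < n) (hpm : p ≤ m)
    (A₁ A₁' : Matrix (Fin (n - p)) (Fin (n - p)) R)
    (B₁ B₁' : Matrix (Fin (n - p)) (Fin p) R) :
    FeedbackEquiv R
        (Matrix.fromBlocks 0 0 B₁ A₁)
        (Matrix.fromBlocks (1 : Matrix (Fin p) (Fin p) R) 0 0
          (0 : Matrix (Fin (n - p)) (Fin (m - p)) R))
        (Matrix.fromBlocks 0 0 B₁' A₁')
        (Matrix.fromBlocks (1 : Matrix (Fin p) (Fin p) R) 0 0
          (0 : Matrix (Fin (n - p)) (Fin (m - p)) R)) ↔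
      FeedbackEquiv R A₁ B₁ A₁' B₁' := by
  exact ⟨FeedbackEquiv.of_fromBlocks, FeedbackEquiv.fromBlocks⟩
end

section
/- Let R be a commutative ring, 0 < m < n, and let (A_1,B_1) be a reachable system of size (n−m, m) over R which is in Brunovski form, with controllability indices κ_1 ≥ … ≥ κ_m (padded with zeros to length m). Then the system (A,B) of size (n,m) with A = [[0,0],[B_1,A_1]] and B = [[I_m],[0]] is reachable, and there exist permutation matrices P ∈ R^{n×n} and Π ∈ R^{m×m} such that (P A P⁻¹, P B Π) is in Brunovski form with controllability indices λ_i = κ_i + 1 for i = 1,…,m. -/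
open Matrix

/-- The module of states reachable in at most `k` steps: the span of the
columns of `[B | AB | ... | A^(k-1)B]`. -/
def Nmod {n m : Type*} [Fintype n] [DecidableEq n] [Fintype m]
    (R : Type*) [CommRing R]
    (A : Matrix n n R) (B : Matrix n m R) (k : ℕ) : Submodule R (n → R) :=
  Submodule.span R { x : n → R | ∃ i < k, ∃ j : m, x = fun p => (A ^ i * B) p j }

/-- A system `(A, B)` is reachable if the columns of `[B | AB | ... | A^(n-1)B]`
generate all of `R^n`. -/
def SysReachable {n m : Type*} [Fintype n] [DecidableEq n] [Fintype m]
    (R : Type*) [CommRing R]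
    (A : Matrix n n R) (B : Matrix n m R) : Prop :=
  Nmod R A B (Fintype.card n) = ⊤

/-- `(A, B)` is in Brunovski form with controllability indices `κ`
(listed in decreasing order, padded with zeros, summing to `n`):
`A` is block diagonal with lower-shift blocks of sizes `κ i` and the nonzero
columns of `B` are the canonical basis vectors at the start of each block. -/
def IsBrunovskiForm {n m : ℕ} (R : Type*) [CommRing R]
    (A : Matrix (Fin n) (Fin n) R) (B : Matrix (Fin n) (Fin m) R)
    (κ : Fin m → ℕ) : Prop :=
  Antitone κ ∧ (∑ i, κ i = n) ∧
  (∀ p q : Fin n, A p q =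
      if (p : ℕ) = (q : ℕ) + 1 ∧ ∀ j : Fin m, (p : ℕ) ≠ ∑ i ∈ Finset.Iio j, κ i then 1 else 0) ∧
  (∀ (p : Fin n) (j : Fin m), B p j =
      if (p : ℕ) = (∑ i ∈ Finset.Iio j, κ i) ∧ 0 < κ j then 1 else 0)

theorem Nmod_mono {n m R : Type*} [Fintype n] [DecidableEq n] [Fintype m] [CommRing R]
    (A : Matrix n n R) (B : Matrix n m R) : Monotone (Nmod R A B) := by
  intro k l hkl
  refine Submodule.span_mono ?_
  rintro x ⟨i, hi, j, rfl⟩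
  exact ⟨i, hi.trans_le hkl, j, rfl⟩

theorem Nmod_reindex {n n' m R : Type*} [Fintype n] [DecidableEq n] [Fintype n'] [DecidableEq n']
    [Fintype m] [CommRing R] (e : n ≃ n') (A : Matrix n n R) (B : Matrix n m R) (k : ℕ) :
    Nmod R (reindex e e A) (reindex e (Equiv.refl m) B) k =
      (Nmod R A B k).map (LinearEquiv.funCongrLeft R R e.symm : (n → R) →ₗ[R] (n' → R)) := by
  have hmul (i : ℕ) : reindex e e A ^ i * reindex e (Equiv.refl m) B =
      (A ^ i * B).submatrix e.symm id := by
    rw [← coe_reindexRingEquiv, ← map_pow]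
    exact submatrix_mul_equiv _ _ _ _ _
  rw [Nmod, Nmod, Submodule.map_span]
  congr 1
  ext x
  simp only [Set.mem_ofPred_eq, Set.mem_image, hmul]
  constructor
  · rintro ⟨i, hi, j, rfl⟩
    exact ⟨_, ⟨i, hi, j, rfl⟩, rfl⟩
  · rintro ⟨_, ⟨i, hi, j, rfl⟩, rfl⟩
    exact ⟨i, hi, j, rfl⟩

theorem fromBlocks_pow_succ_mul_fromRows {n m R : Type*} [Fintype n] [DecidableEq n] [Fintype m]
    [DecidableEq m] [CommRing R] (A : Matrix n n R) (B : Matrix n m R) (i : ℕ) :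
    fromBlocks (0 : Matrix m m R) 0 B A ^ (i + 1) *
        fromRows (1 : Matrix m m R) (0 : Matrix n m R) =
      fromRows (0 : Matrix m m R) (A ^ i * B) := by
  induction i with
  | zero => simp [fromBlocks_mul_fromRows]
  | succ i ih =>
    rw [pow_succ', Matrix.mul_assoc, ih, fromBlocks_mul_fromRows]
    simp [pow_succ', Matrix.mul_assoc]

theorem Nmod_fromBlocks_eq_top {n m R : Type*} [Fintype n] [DecidableEq n] [Fintype m]
    [DecidableEq m] [CommRing R] (A : Matrix n n R) (B : Matrix n m R) {k : ℕ}
    (h : Nmod R A B k = ⊤) :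
    Nmod R (fromBlocks (0 : Matrix m m R) 0 B A) (fromRows (1 : Matrix m m R) 0) (k + 1) = ⊤ := by
  set N := Nmod R (fromBlocks (0 : Matrix m m R) 0 B A) (fromRows (1 : Matrix m m R) 0) (k + 1)
  have hinr (v : n → R) : Sum.elim (0 : m → R) v ∈ N := by
    have hv : v ∈ Nmod R A B k := h ▸ Submodule.mem_top
    refine Submodule.span_induction (p := fun v _ => Sum.elim (0 : m → R) v ∈ N)
      ?_ ?_ ?_ ?_ hv
    · rintro _ ⟨i, hi, j, rfl⟩
      refine Submodule.subset_span ⟨i + 1, by omega, j, ?_⟩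
      rw [fromBlocks_pow_succ_mul_fromRows]
      ext (p | p) <;> rfl
    · convert N.zero_mem using 1
      ext (p | p) <;> rfl
    · intro x y _ _ hx hy
      convert N.add_mem hx hy using 1
      ext (p | p) <;> simp
    · intro a x _ hx
      convert N.smul_mem a hx using 1
      ext (p | p) <;> simp
  have hinl (j : m) : Sum.elim (Pi.single j (1 : R)) (0 : n → R) ∈ N := by
    refine Submodule.subset_span ⟨0, by omega, j, ?_⟩
    ext (p | p) <;> simp [one_apply, Pi.single_apply]
  refine Submodule.eq_top_iff'.2 fun x => ?_
  convert N.add_mem (N.sum_mem fun j (_ : j ∈ Finset.univ) => N.smul_mem (x (Sum.inl j)) (hinl j))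
    (hinr (x ∘ Sum.inr)) using 1
  ext (p | p) <;> simp [Finset.sum_apply, Pi.single_apply]

theorem SysReachable.fromBlocks {n m R : Type*} [Fintype n] [DecidableEq n] [Fintype m]
    [DecidableEq m] [Nonempty m] [CommRing R] {A : Matrix n n R} {B : Matrix n m R}
    (h : SysReachable R A B) :
    SysReachable R (fromBlocks (0 : Matrix m m R) 0 B A) (fromRows (1 : Matrix m m R) 0) := by
  refine top_le_iff.1 ((Nmod_fromBlocks_eq_top A B h).ge.trans (Nmod_mono _ _ ?_))
  have := Fintype.card_pos (α := m)
  rw [Fintype.card_sum]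
  omega

theorem SysReachable.reindex {n n' m R : Type*} [Fintype n] [DecidableEq n] [Fintype n']
    [DecidableEq n'] [Fintype m] [CommRing R] {A : Matrix n n R} {B : Matrix n m R}
    (h : SysReachable R A B) (e : n ≃ n') :
    SysReachable R (Matrix.reindex e e A) (Matrix.reindex e (Equiv.refl m) B) := by
  rw [SysReachable, Nmod_reindex, ← Fintype.card_congr e, h, Submodule.map_top]
  exact LinearEquiv.range _

/-- The position in `Fin n` of the `k.2`-th state of the `k.1`-th block. -/
def blockEquiv {n m : ℕ} (κ : Fin m → ℕ) (h : ∑ i, κ i = n) : (Σ i, Fin (κ i)) ≃ Fin n :=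
  finSigmaFinEquiv.trans (finCongr h)

theorem blockEquiv_val {n m : ℕ} (κ : Fin m → ℕ) (h : ∑ i, κ i = n) (k : Σ i, Fin (κ i)) :
    (blockEquiv κ h k : ℕ) = ∑ i ∈ Finset.Iio k.1, κ i + k.2 := by
  simp only [blockEquiv, Equiv.trans_apply, finCongr_apply, Fin.val_cast, finSigmaFinEquiv_apply,
    add_left_inj]
  refine Finset.sum_bij (fun i _ => Fin.castLE k.1.2.le i) ?_ ?_ ?_ ?_
  · exact fun i _ => Finset.mem_Iio.2 i.2
  · intro i _ j _ hij
    simpa using hij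
  · intro j hj
    exact ⟨⟨j, Fin.lt_def.1 (Finset.mem_Iio.1 hj)⟩, Finset.mem_univ _, rfl⟩
  · simp

theorem sum_Iio_add_le {m : ℕ} (κ : Fin m → ℕ) {i j : Fin m} (h : i < j) :
    ∑ l ∈ Finset.Iio i, κ l + κ i ≤ ∑ l ∈ Finset.Iio j, κ l := by
  rw [add_comm, ← Finset.sum_insert (s := Finset.Iio i) (a := i) (f := κ) (by simp)]
  refine Finset.sum_le_sum_of_subset fun l hl => ?_
  simp only [Finset.mem_insert, Finset.mem_Iio] at hl ⊢
  rcases hl with rfl | hl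
  · exact h
  · exact hl.trans h

theorem blockEquiv_val_eq_start_iff {n m : ℕ} (κ : Fin m → ℕ) (h : ∑ i, κ i = n)
    (k : Σ i, Fin (κ i)) (j : Fin m) :
    ((blockEquiv κ h k : ℕ) = ∑ i ∈ Finset.Iio j, κ i ∧ 0 < κ j) ↔ k.1 = j ∧ (k.2 : ℕ) = 0 := by
  constructor
  · rintro ⟨hk, hj⟩
    have hk' : k = ⟨j, ⟨0, hj⟩⟩ := by
      apply (blockEquiv κ h).injective
      apply Fin.ext
      rw [hk, blockEquiv_val]
      simp
    subst hk'
    exact ⟨rfl, rfl⟩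
  · rintro ⟨rfl, hk⟩
    exact ⟨by rw [blockEquiv_val, hk, add_zero], k.2.pos⟩

theorem blockEquiv_val_eq_succ_iff {n m : ℕ} (κ : Fin m → ℕ) (h : ∑ i, κ i = n)
    (k l : Σ i, Fin (κ i)) :
    ((blockEquiv κ h k : ℕ) = blockEquiv κ h l + 1 ∧
        ∀ j : Fin m, (blockEquiv κ h k : ℕ) ≠ ∑ i ∈ Finset.Iio j, κ i) ↔
      k.1 = l.1 ∧ (k.2 : ℕ) = l.2 + 1 := by
  obtain ⟨i, s⟩ := k
  constructor
  · rintro ⟨hkl, hk⟩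
    have hs : (s : ℕ) ≠ 0 := fun hs => hk i (by rw [blockEquiv_val]; simp [hs])
    have hl : l = ⟨i, ⟨s - 1, (Nat.sub_le _ _).trans_lt s.2⟩⟩ := by
      apply (blockEquiv κ h).injective
      apply Fin.ext
      rw [blockEquiv_val κ h ⟨i, s⟩] at hkl
      rw [blockEquiv_val κ h ⟨i, _⟩]
      simp only at hkl ⊢
      omega
    rw [hl]
    exact ⟨rfl, by simp only; omega⟩
  · obtain ⟨i', t⟩ := l
    simp only
    rintro ⟨rfl, hst⟩
    refine ⟨by rw [blockEquiv_val, blockEquiv_val]; simp only; omega, fun j hj => ?_⟩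
    rw [blockEquiv_val] at hj
    simp only at hj
    have := s.2
    rcases lt_trichotomy i j with hij | rfl | hij
    · have := sum_Iio_add_le κ hij
      omega
    · omega
    · have := sum_Iio_add_le κ hij
      omega

theorem isBrunovskiForm_iff {n m : ℕ} {R : Type*} [CommRing R] (A : Matrix (Fin n) (Fin n) R)
    (B : Matrix (Fin n) (Fin m) R) (κ : Fin m → ℕ) (h : ∑ i, κ i = n) :
    IsBrunovskiForm R A B κ ↔ Antitone κ ∧
      (∀ k l, A (blockEquiv κ h k) (blockEquiv κ h l) =
        if k.1 = l.1 ∧ (k.2 : ℕ) = l.2 + 1 then 1 else 0) ∧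
      (∀ k j, B (blockEquiv κ h k) j = if k.1 = j ∧ (k.2 : ℕ) = 0 then 1 else 0) := by
  simp only [IsBrunovskiForm, h, true_and, (blockEquiv κ h).surjective.forall,
    blockEquiv_val_eq_succ_iff, blockEquiv_val_eq_start_iff]

/-- Splitting off the first state of each block. -/
def blockSuccEquiv {m : ℕ} (κ : Fin m → ℕ) :
    (Σ i, Fin (κ i + 1)) ≃ Fin m ⊕ Σ i, Fin (κ i) where
  toFun k := Fin.cases (Sum.inl k.1) (fun s => Sum.inr ⟨k.1, s⟩) k.2
  invFun := Sum.elim (fun i => ⟨i, 0⟩) (fun k => ⟨k.1, k.2.succ⟩)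
  left_inv := by
    rintro ⟨i, s⟩
    cases s using Fin.cases <;> rfl
  right_inv := by rintro (i | k) <;> rfl

theorem IsBrunovskiForm.exists_perm_fromBlocks {n N m : ℕ} {R : Type*} [CommRing R]
    {A : Matrix (Fin n) (Fin n) R} {B : Matrix (Fin n) (Fin m) R} {κ : Fin m → ℕ}
    (h : IsBrunovskiForm R A B κ) (e : Fin m ⊕ Fin n ≃ Fin N) :
    ∃ σ : Equiv.Perm (Fin N), IsBrunovskiForm R
      ((reindex e e (fromBlocks (0 : Matrix (Fin m) (Fin m) R) 0 B A)).submatrix σ σ)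
      ((reindex e (Equiv.refl _) (fromRows (1 : Matrix (Fin m) (Fin m) R) 0)).submatrix σ id)
      (fun i => κ i + 1) := by
  have hκ : ∑ i, κ i = n := h.2.1
  have hN : ∑ i, (κ i + 1) = N := by
    have := Fintype.card_congr e
    simp only [Fintype.card_sum, Fintype.card_fin] at this
    simp only [Finset.sum_add_distrib, hκ, Finset.sum_const, Finset.card_univ, Fintype.card_fin,
      smul_eq_mul, mul_one]
    omega
  rw [isBrunovskiForm_iff _ _ _ hκ] at h
  obtain ⟨hanti, hA, hB⟩ := h
  refine ⟨(blockEquiv _ hN).symm.trans ((blockSuccEquiv κ).trans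
    (((Equiv.refl _).sumCongr (blockEquiv κ hκ)).trans e)), ?_⟩
  rw [isBrunovskiForm_iff _ _ _ hN]
  refine ⟨fun i j hij => Nat.succ_le_succ (hanti hij), ?_, ?_⟩
  · rintro ⟨i, s⟩ ⟨j, t⟩
    cases s using Fin.cases <;> cases t using Fin.cases <;>
      simp [blockSuccEquiv, hA, hB]
  · rintro ⟨i, s⟩ j
    cases s using Fin.cases <;> simp [blockSuccEquiv, one_apply]

/-- if `(A₁, B₁)` of size `(n-m, m)` is reachable and in Brunovski
form with indices `κ₁ ≥ ... ≥ κ_m`, then the augmented system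
`A = [[0,0],[B₁,A₁]]`, `B = [[I],[0]]` of size `(n, m)` is reachable and can be
brought, by conjugating with a permutation matrix `P` and multiplying `B` on the
right by a permutation matrix `Π`, to Brunovski form with indices `λᵢ = κᵢ + 1`. -/
theorem brunovski_augmentation
    {R : Type*} [CommRing R] {n m : ℕ} (hm : 0 < m) (hmn : m < n)
    (A₁ : Matrix (Fin (n - m)) (Fin (n - m)) R)
    (B₁ : Matrix (Fin (n - m)) (Fin m) R)
    (κ : Fin m → ℕ)
    (hreach₁ : SysReachable R A₁ B₁)
    (hbrun₁ : IsBrunovskiForm R A₁ B₁ κ)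
    (e : Fin m ⊕ Fin (n - m) ≃ Fin n)
    (he : e = finSumFinEquiv.trans (finCongr (by omega)))
    (A : Matrix (Fin n) (Fin n) R)
    (hA : A = (Matrix.reindex e e) (Matrix.fromBlocks 0 0 B₁ A₁))
    (B : Matrix (Fin n) (Fin m) R)
    (hB : B = (Matrix.reindex e (Equiv.refl (Fin m)))
        (Matrix.fromRows (1 : Matrix (Fin m) (Fin m) R) 0)) :
    SysReachable R A B ∧
      ∃ (σ : Equiv.Perm (Fin n)) (τ : Equiv.Perm (Fin m)),
        IsBrunovskiForm R
          ((σ.permMatrix R) * A * ((σ⁻¹).permMatrix R))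
          ((σ.permMatrix R) * B * (τ.permMatrix R))
          (fun i => κ i + 1) := by
  subst hA hB
  have : NeZero m := ⟨hm.ne'⟩
  refine ⟨hreach₁.fromBlocks.reindex e, ?_⟩
  obtain ⟨σ, hσ⟩ := hbrun₁.exists_perm_fromBlocks e
  refine ⟨σ, 1, ?_⟩
  rw [permMatrix_one, Matrix.mul_one, Equiv.Perm.permMatrix, Equiv.Perm.permMatrix,
    PEquiv.toMatrix_toPEquiv_mul, PEquiv.toMatrix_toPEquiv_mul, PEquiv.mul_toMatrix_toPEquiv]
  exact hσ
end

section
/- Every system (A,B) of size (n,m) over a commutative von Neumann regular ring R is feedback equivalent to a system (A',B') in reduced form, meaning: B' = [[diag(d_1,…,d_r), 0],[0,0]] where d_1,…,d_r are nonzero idempotents of R with d_1 | d_2 | … | d_r (i.e., d_i d_{i+1} = d_{i+1} for each i), and for each i = 1,…,r the i-th row of A' is orthogonal to d_i (d_i · a'_{ij} = 0 for all j). If r = n or r = m the corresponding zero blocks of B' do not occur. -/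
open Matrix

/-- A system `(A, B)` is in reduced form when
`B = [[diag(d₁,…,d_r), 0],[0,0]]` with `d₁ | d₂ | ⋯ | d_r` nonzero idempotents,
and for `i = 1,…,r` the `i`-th row of `A` is orthogonal to `d_i`. -/
def IsReducedForm {n m : ℕ} (R : Type*) [CommRing R]
    (A : Matrix (Fin n) (Fin n) R) (B : Matrix (Fin n) (Fin m) R) : Prop :=
  ∃ (r : ℕ) (_ : r ≤ min n m) (d : Fin r → R),
    (∀ i, IsIdempotentElem (d i) ∧ d i ≠ 0) ∧
    (∀ (i : Fin r) (h : (i : ℕ) + 1 < r), d i * d ⟨(i : ℕ) + 1, h⟩ = d ⟨(i : ℕ) + 1, h⟩) ∧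
    (∀ (i : Fin n) (j : Fin m),
      B i j = if h : (i : ℕ) = (j : ℕ) ∧ (i : ℕ) < r then d ⟨(i : ℕ), h.2⟩ else 0) ∧
    (∀ (i : Fin n) (h : (i : ℕ) < r) (j : Fin n), d ⟨(i : ℕ), h⟩ * A i j = 0)

namespace Matrix

variable {R : Type*} [CommRing R]

section Patching

variable {l m n : Type*} [Fintype m]

/-- Multiplication is compatible with gluing two matrices along an idempotent. -/
theorem patch_mul_patch {e : R} (he : IsIdempotentElem e) (X Y : Matrix l m R)
    (Z W : Matrix m n R) :
    ((1 - e) • X + e • Y) * ((1 - e) • Z + e • W) = (1 - e) • (X * Z) + e • (Y * W) := by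
  have h1 : e * (1 - e) = 0 := he.mul_one_sub_self
  have h2 : (1 - e) * e = 0 := he.one_sub_mul_self
  have h3 : (1 - e) * (1 - e) = 1 - e := he.one_sub
  have h4 : e * e = e := he
  simp only [Matrix.add_mul, Matrix.mul_add, Matrix.smul_mul, Matrix.mul_smul, smul_add, smul_smul,
    h1, h2, h3, h4, zero_smul, zero_add, add_zero]

theorem patch_self (e : R) (X : Matrix l n R) : (1 - e) • X + e • X = X := by
  rw [← add_smul, sub_add_cancel, one_smul]

/-- Gluing two invertible matrices along an idempotent gives an invertible matrix. -/
theorem isUnit_patch [DecidableEq m] {e : R} (he : IsIdempotentElem e) {X Y : Matrix m m R}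
    (hX : IsUnit X) (hY : IsUnit Y) : IsUnit ((1 - e) • X + e • Y) := by
  obtain ⟨X', h1, h2⟩ := isUnit_iff_exists.1 hX
  obtain ⟨Y', h3, h4⟩ := isUnit_iff_exists.1 hY
  refine isUnit_iff_exists.2 ⟨(1 - e) • X' + e • Y', ?_, ?_⟩
  · rw [patch_mul_patch he, h1, h3, patch_self]
  · rw [patch_mul_patch he, h2, h4, patch_self]

end Patching

section Swap

variable {m n : Type*} [Fintype m] [DecidableEq m]

theorem isUnit_one_submatrix_swap (i j : m) :
    IsUnit ((1 : Matrix m m R).submatrix (Equiv.swap i j) (Equiv.refl m)) := by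
  have h : (1 : Matrix m m R).submatrix (Equiv.swap i j) (Equiv.refl m) *
      (1 : Matrix m m R).submatrix (Equiv.swap i j) (Equiv.refl m) = 1 := by
    rw [one_submatrix_mul, submatrix_submatrix]
    ext a b
    simp [one_apply]
  exact isUnit_iff_exists.2 ⟨_, h, h⟩

end Swap

section Transvection

variable {m : Type*} [Fintype m] [DecidableEq m]

theorem isUnit_one_sub_of_mul_self_eq_zero {N : Matrix m m R} (hN : N * N = 0) :
    IsUnit (1 - N) := by
  refine isUnit_iff_exists.2 ⟨1 + N, ?_, ?_⟩
  · simp [Matrix.sub_mul, Matrix.mul_add, hN]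
  · simp [Matrix.add_mul, Matrix.mul_sub, hN]

end Transvection

/-- Left and right multiplication by invertible matrices. -/
def TwoSidedEquiv {m n : Type*} [Fintype m] [DecidableEq m] [Fintype n] [DecidableEq n]
    (B B' : Matrix m n R) : Prop :=
  ∃ (P : Matrix m m R) (Q : Matrix n n R), IsUnit P ∧ IsUnit Q ∧ B' = P * B * Q

namespace TwoSidedEquiv

variable {m n : Type*} [Fintype m] [DecidableEq m] [Fintype n] [DecidableEq n]
  {B B' B'' : Matrix m n R}

theorem refl (B : Matrix m n R) : TwoSidedEquiv B B :=
  ⟨1, 1, isUnit_one, isUnit_one, by simp⟩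

theorem trans (h : TwoSidedEquiv B B') (h' : TwoSidedEquiv B' B'') : TwoSidedEquiv B B'' := by
  obtain ⟨P, Q, hP, hQ, rfl⟩ := h
  obtain ⟨P', Q', hP', hQ', rfl⟩ := h'
  exact ⟨P' * P, Q * Q', hP'.mul hP, hQ.mul hQ', by simp only [Matrix.mul_assoc]⟩

theorem smul_eq_self (h : TwoSidedEquiv B B') {c : R} (hc : c • B = B) : c • B' = B' := by
  obtain ⟨P, Q, -, -, rfl⟩ := h
  rw [← Matrix.smul_mul, ← Matrix.mul_smul, hc]

theorem patch (h : TwoSidedEquiv B B') (h' : TwoSidedEquiv B B'') {e : R}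
    (he : IsIdempotentElem e) : TwoSidedEquiv B ((1 - e) • B' + e • B'') := by
  obtain ⟨P, Q, hP, hQ, rfl⟩ := h
  obtain ⟨P', Q', hP', hQ', rfl⟩ := h'
  refine ⟨_, _, isUnit_patch he hP hP', isUnit_patch he hQ hQ', ?_⟩
  conv_rhs => rw [← patch_self e B, patch_mul_patch he, patch_mul_patch he]

theorem smul (B : Matrix m n R) {u : R} (hu : IsUnit u) : TwoSidedEquiv B (u • B) :=
  ⟨algebraMap R _ u, 1, hu.map _, isUnit_one, by
    rw [Matrix.mul_one, Algebra.algebraMap_eq_smul_one, Matrix.smul_mul, Matrix.one_mul]⟩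

theorem submatrix_swap (B : Matrix m n R) (i k : m) (j l : n) :
    TwoSidedEquiv B (B.submatrix (Equiv.swap i k) (Equiv.swap j l)) := by
  refine ⟨_, _, isUnit_one_submatrix_swap i k, isUnit_one_submatrix_swap j l, ?_⟩
  rw [one_submatrix_mul, mul_submatrix_one]
  ext a b
  simp

end TwoSidedEquiv

/-- Over a von Neumann regular ring, some equivalent matrix has at a prescribed position an
idempotent generating the ideal spanned by a prescribed finite set of entries. -/
theorem exists_twoSidedEquiv_pivot (hreg : ∀ a : R, ∃ x : R, a ^ 2 * x = a)
    {m n : Type*} [Fintype m] [DecidableEq m] [Fintype n] [DecidableEq n]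
    (B : Matrix m n R) (i₀ : m) (j₀ : n) (S : Finset (m × n)) :
    ∃ (e : R) (B' : Matrix m n R), IsIdempotentElem e ∧ TwoSidedEquiv B B' ∧
      e * B' i₀ j₀ = e ∧ ∀ p ∈ S, e * B p.1 p.2 = B p.1 p.2 := by
  induction S using Finset.induction_on with
  | empty => exact ⟨0, B, .zero, .refl B, by simp, by simp⟩
  | insert p S _ ih =>
    obtain ⟨e, B', he, hB, h0, hS⟩ := ih
    obtain ⟨x, hx⟩ := hreg (B p.1 p.2)
    set b := B p.1 p.2 with hb
    have he' : e * e = e := he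
    obtain ⟨f, hf⟩ : ∃ f, f = (1 - e) * (b * x) := ⟨_, rfl⟩
    have hff : f * f = f := by
      rw [hf]; linear_combination b * x * b * x * he' + (1 - e) * x * hx
    have hef : e * f = 0 := by rw [hf]; linear_combination - b * x * he'
    have hfx : f * (b * x) = f := by rw [hf]; linear_combination (1 - e) * x * hx
    have hu : IsUnit (f * x + (1 - f)) := by
      refine IsUnit.of_mul_eq_one (f * b + (1 - f)) ?_
      linear_combination (b * x - x - b + 1) * hff + hfx
    have hB₂ := (TwoSidedEquiv.submatrix_swap B i₀ p.1 j₀ p.2).trans (.smul _ hu)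
    refine ⟨e + f, _, ?_, hB.patch hB₂ hff, ?_, ?_⟩
    · show (e + f) * (e + f) = e + f
      linear_combination he' + hff + 2 * hef
    · simp only [add_apply, smul_apply, submatrix_apply, Equiv.swap_apply_left, smul_eq_mul,
        ← hb]
      generalize B' i₀ j₀ = a at *
      linear_combination (1 - f) * h0 + ((f * x + 1 - f) * b - a) * hef +
        (b * x - a) * hff + f * b * (x - 1) * hff + (a - 1) * hef + hfx
    · intro q hq
      have hfb : f * b = (1 - e) * b := by rw [hf]; linear_combination (1 - e) * hx
      rcases Finset.mem_insert.1 hq with rfl | hq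
      · rw [← hb]; linear_combination hfb
      · have := hS q hq
        linear_combination (1 - f) * this + B q.1 q.2 * hef

/-- The block diagonal matrix with blocks `a` (of size one) and `X`. -/
def consDiag {n m : ℕ} (a : R) (X : Matrix (Fin n) (Fin m) R) :
    Matrix (Fin (n + 1)) (Fin (m + 1)) R :=
  of (Fin.cons (Fin.cons a 0) fun i => Fin.cons 0 (X i))

theorem consDiag_mul {l n m : ℕ} (a b : R) (X : Matrix (Fin l) (Fin n) R)
    (Y : Matrix (Fin n) (Fin m) R) :
    consDiag a X * consDiag b Y = consDiag (a * b) (X * Y) := by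
  ext i j
  cases i using Fin.cases <;> cases j using Fin.cases <;>
    simp [consDiag, mul_apply, Fin.sum_univ_succ]

theorem consDiag_one_one {n : ℕ} : consDiag (1 : R) (1 : Matrix (Fin n) (Fin n) R) = 1 := by
  ext i j
  cases i using Fin.cases <;> cases j using Fin.cases <;>
    simp [consDiag, one_apply, Fin.succ_ne_zero, (Fin.succ_ne_zero _).symm]

theorem isUnit_consDiag_one {n : ℕ} {X : Matrix (Fin n) (Fin n) R} (hX : IsUnit X) :
    IsUnit (consDiag 1 X) := by
  obtain ⟨X', h1, h2⟩ := isUnit_iff_exists.1 hX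
  refine isUnit_iff_exists.2 ⟨consDiag 1 X', ?_, ?_⟩
  · rw [consDiag_mul, h1, mul_one, consDiag_one_one]
  · rw [consDiag_mul, h2, mul_one, consDiag_one_one]

theorem TwoSidedEquiv.consDiag {n m : ℕ} (a : R) {X Y : Matrix (Fin n) (Fin m) R}
    (h : TwoSidedEquiv X Y) : TwoSidedEquiv (consDiag a X) (consDiag a Y) := by
  obtain ⟨P, Q, hP, hQ, rfl⟩ := h
  exact ⟨_, _, isUnit_consDiag_one hP, isUnit_consDiag_one hQ, by simp [consDiag_mul]⟩

/-- A matrix whose corner entry acts as the identity on it is equivalent to a block diagonal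
matrix with the same corner. -/
theorem exists_twoSidedEquiv_consDiag {n m : ℕ} (B : Matrix (Fin (n + 1)) (Fin (m + 1)) R)
    (hB : B 0 0 • B = B) :
    ∃ X : Matrix (Fin n) (Fin m) R, TwoSidedEquiv B (consDiag (B 0 0) X) := by
  have hB' (i j) : B 0 0 * B i j = B i j := congrFun (congrFun hB i) j
  let c : Fin (n + 1) → R := Fin.cons 0 fun i => B i.succ 0
  let r : Fin (m + 1) → R := Fin.cons 0 fun j => B 0 j.succ
  refine ⟨of fun i j => B i.succ j.succ - B i.succ 0 * B 0 j.succ,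
    1 - vecMulVec c (Pi.single 0 1), 1 - vecMulVec (Pi.single 0 1) r,
    isUnit_one_sub_of_mul_self_eq_zero ?_, isUnit_one_sub_of_mul_self_eq_zero ?_, ?_⟩
  · rw [vecMulVec_mul_vecMulVec]; simp [c]
  · rw [vecMulVec_mul_vecMulVec]; simp [r]
  · rw [Matrix.sub_mul, Matrix.one_mul, Matrix.mul_sub, Matrix.mul_one, mul_vecMulVec,
      vecMulVec_mul]
    ext i j
    cases i using Fin.cases <;> cases j using Fin.cases <;>
      simp [Matrix.consDiag, c, r, vecMulVec_apply, hB', mul_comm _ (B 0 0)]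

/-- Smith normal form over a commutative von Neumann regular ring. -/
theorem exists_twoSidedEquiv_diagonal (hreg : ∀ a : R, ∃ x : R, a ^ 2 * x = a)
    {n m : ℕ} (B : Matrix (Fin n) (Fin m) R) :
    ∃ (d : ℕ → R), (∀ i, IsIdempotentElem (d i)) ∧ (∀ i, d i * d (i + 1) = d (i + 1)) ∧
      (∀ c : R, c • B = B → ∀ i, c * d i = d i) ∧
      TwoSidedEquiv B (of fun i j => if (i : ℕ) = j then d i else 0) := by
  induction n generalizing m with
  | zero =>
    refine ⟨0, fun _ => .zero, by simp, by simp, ?_⟩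
    convert TwoSidedEquiv.refl B using 1
    exact Subsingleton.elim _ _
  | succ n ih =>
    cases m with
    | zero =>
      refine ⟨0, fun _ => .zero, by simp, by simp, ?_⟩
      convert TwoSidedEquiv.refl B using 1
      exact Subsingleton.elim _ _
    | succ m =>
      obtain ⟨e, B', he, hBB', h0, hS⟩ := exists_twoSidedEquiv_pivot hreg B 0 0 Finset.univ
      have heB : e • B = B := by ext i j; exact hS (i, j) (Finset.mem_univ _)
      have heB' := hBB'.smul_eq_self heB
      have h00 : B' 0 0 = e := by
        rw [← h0]; exact (congrFun (congrFun heB' 0) 0).symm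
      obtain ⟨X, hX⟩ := exists_twoSidedEquiv_consDiag B' (by rw [h00, heB'])
      rw [h00] at hX
      have hBX := hBB'.trans hX
      obtain ⟨d, hd, hdd, hcd, hXd⟩ := ih X
      have key (c : R) (hc : c • B = B) : c * e = e ∧ ∀ i, c * d i = d i := by
        have h := hBX.smul_eq_self hc
        refine ⟨congrFun (congrFun h 0) 0, hcd c ?_⟩
        ext i j
        exact congrFun (congrFun h i.succ) j.succ
      refine ⟨fun i => Nat.casesOn i e d, ?_, ?_, ?_, ?_⟩
      · rintro (_ | i)
        exacts [he, hd i]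
      · rintro (_ | i)
        exacts [(key e heB).2 0, hdd i]
      · rintro c hc (_ | i)
        exacts [(key c hc).1, (key c hc).2 i]
      · convert hBX.trans (hXd.consDiag e) using 1
        ext i j
        cases i using Fin.cases <;> cases j using Fin.cases <;> simp [Matrix.consDiag]

end Matrix

/-- every system over a commutative von Neumann regular ring is
feedback equivalent to a system in reduced form. -/
theorem feedbackEquiv_to_reducedForm
    {R : Type*} [CommRing R]
    (hreg : ∀ a : R, ∃ x : R, a ^ 2 * x = a)
    {n m : ℕ}
    (A : Matrix (Fin n) (Fin n) R) (B : Matrix (Fin n) (Fin m) R) :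
    ∃ (A' : Matrix (Fin n) (Fin n) R) (B' : Matrix (Fin n) (Fin m) R),
      FeedbackEquiv R A B A' B' ∧ IsReducedForm R A' B' := by
  obtain ⟨d, hd, hdd, -, P, Q, hP, hQ, hD⟩ := exists_twoSidedEquiv_diagonal hreg B
  obtain ⟨P, rfl⟩ := hP
  obtain ⟨Q, rfl⟩ := hQ
  set D : Matrix (Fin n) (Fin m) R := of fun i j => if (i : ℕ) = j then d i else 0 with hDdef
  set C : Matrix (Fin n) (Fin n) R := P * A * ((P⁻¹ : GL (Fin n) R) : Matrix (Fin n) (Fin n) R)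
  have hzero {i j : ℕ} (hij : i ≤ j) (hi : d i = 0) : d j = 0 := by
    induction j, hij using Nat.le_induction with
    | base => exact hi
    | succ j _ ih => rw [← hdd, ih, zero_mul]
  classical
  have hex : ∃ r, min n m ≤ r ∨ d r = 0 := ⟨_, .inl le_rfl⟩
  have hne {i : ℕ} (hi : i < Nat.find hex) : i < min n m ∧ d i ≠ 0 := by
    simpa using Nat.find_min hex hi
  have hge {i : ℕ} (hn : i < n) (hm : i < m) (hi : ¬ i < Nat.find hex) : d i = 0 := by
    rcases Nat.find_spec hex with h | h
    · omega
    · exact hzero (not_lt.1 hi) h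
  refine ⟨C - D * (Dᵀ * C), D, ⟨P, Q, -((Q : Matrix (Fin m) (Fin m) R) * (Dᵀ * C) * (P : Matrix (Fin n) (Fin n) R)), ?_, hD⟩,
    Nat.find hex, Nat.find_min' hex (.inl le_rfl), fun i => d i,
    fun i => ⟨hd i, (hne i.2).2⟩, fun i _ => hdd i, ?_, ?_⟩
  · have h : (P : Matrix (Fin n) (Fin n) R) * (B * ((Q : Matrix (Fin m) (Fin m) R) * (Dᵀ * C) * (P : Matrix (Fin n) (Fin n) R))) *
        ((P⁻¹ : GL (Fin n) R) : Matrix (Fin n) (Fin n) R) = D * (Dᵀ * C) := by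
      rw [hD]
      simp only [Matrix.mul_assoc, Units.mul_inv, Matrix.mul_one]
    rw [Matrix.mul_neg, ← sub_eq_add_neg, Matrix.mul_sub, Matrix.sub_mul, h]
  · intro i j
    by_cases hij : (i : ℕ) = j
    · by_cases hi : (i : ℕ) < Nat.find hex
      · simp only [hDdef, of_apply, hij, hij ▸ hi, and_self, if_true, dite_true]
      · have := hge i.2 (hij ▸ j.2) hi
        simp only [hDdef, of_apply, hi, and_false, dite_false, this, ite_self]
    · simp [hDdef, hij]
  · intro i hi j
    have him : (i : ℕ) < m := (hne hi).1.trans_le (min_le_right _ _)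
    have hrow (X : Matrix (Fin m) (Fin n) R) : (D * X) i j = d i * X ⟨i, him⟩ j := by
      rw [mul_apply, Finset.sum_eq_single ⟨i, him⟩]
      · simp [hDdef]
      · intro k _ hk
        have : (i : ℕ) ≠ k := fun h => hk (Fin.ext h.symm)
        simp [hDdef, this]
      · simp
    have hcol : (Dᵀ * C) ⟨i, him⟩ j = d i * C i j := by
      rw [mul_apply, Finset.sum_eq_single i]
      · simp [hDdef]
      · intro k _ hk
        have : (k : ℕ) ≠ i := fun h => hk (Fin.ext h)
        simp [hDdef, this]
      · simp
    have hdi : d i * d i = d i := hd i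
    rw [Matrix.sub_apply, hrow, hcol]
    linear_combination (-C i j - d i * C i j) * hdi
end

section
/- Let R be a commutative ring and let D, D' ∈ R^{n×m} be diagonal matrices with diagonal entries d_1,…,d_p and d'_1,…,d'_p respectively (p = min(n,m)), where all d_i and d'_i are idempotents satisfying the divisibility chains d_1 | d_2 | … | d_p and d'_1 | d'_2 | … | d'_p. If D and D' are equivalent matrices (D' = P D Q with P, Q invertible over R), then d_i = d'_i for all i. In particular, an ideal of R cannot be generated by two distinct idempotents: if e, f are idempotents with eR = fR then e = f. -/
open Matrix

/-- Two rectangular matrices are equivalent over `R` if `B' = P * B * Q`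
for some invertible `P`, `Q`. -/
def MatrixEquivRel {n m : Type*} [Fintype n] [DecidableEq n] [Fintype m] [DecidableEq m]
    (R : Type*) [CommRing R] (B B' : Matrix n m R) : Prop :=
  ∃ (P : GL n R) (Q : GL m R), B' = (P : Matrix n n R) * B * (Q : Matrix m m R)

theorem mul_eq_right_of_idempotent_chain {R : Type*} [CommRing R] {p : ℕ} (d : Fin p → R)
    (hidem : ∀ i, IsIdempotentElem (d i))
    (hchain : ∀ (i : Fin p) (h : (i : ℕ) + 1 < p),
      d i * d ⟨(i : ℕ) + 1, h⟩ = d ⟨(i : ℕ) + 1, h⟩)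
    {i j : Fin p} (hij : i ≤ j) : d i * d j = d j := by
  obtain ⟨j, hj⟩ := j
  induction j with
  | zero =>
    obtain rfl : i = ⟨0, hj⟩ := le_antisymm hij (Fin.mk_le_of_le_val (Nat.zero_le _))
    exact hidem _
  | succ j ih =>
    rcases hij.eq_or_lt with rfl | hlt
    · exact hidem _
    · have h := ih (by lia) (Fin.le_def.2 (Nat.lt_succ_iff.1 (Fin.lt_def.1 hlt)))
      rw [← hchain ⟨j, by lia⟩ hj, ← mul_assoc, h]

theorem MatrixEquivRel.symm {n m : Type*} [Fintype n] [DecidableEq n] [Fintype m]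
    [DecidableEq m] {R : Type*} [CommRing R] {B B' : Matrix n m R}
    (h : MatrixEquivRel R B B') : MatrixEquivRel R B' B := by
  obtain ⟨P, Q, rfl⟩ := h
  refine ⟨P⁻¹, Q⁻¹, ?_⟩
  have hP : ((P⁻¹ : GL n R) : Matrix n n R) * (P : Matrix n n R) = 1 := P.inv_mul
  have hQ : (Q : Matrix m m R) * ((Q⁻¹ : GL m R) : Matrix m m R) = 1 := Q.mul_inv
  rw [Matrix.mul_assoc, Matrix.mul_assoc _ _ ((Q⁻¹ : GL m R) : Matrix m m R), hQ,
    Matrix.mul_one, ← Matrix.mul_assoc, hP, Matrix.one_mul]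

/-- If a diagonal matrix with a chain of idempotents on the diagonal is obtained from another one
by multiplication on both sides, then each of its diagonal entries is divisible by the
corresponding one of the original matrix. -/
theorem mul_eq_left_of_eq_mul_idempotent_diagonal_mul
    {R : Type*} [CommRing R] {n m : ℕ}
    (d d' : Fin (min n m) → R)
    (hidem : ∀ i, IsIdempotentElem (d i))
    (hidem' : ∀ i, IsIdempotentElem (d' i))
    (hchain : ∀ (i : Fin (min n m)) (h : (i : ℕ) + 1 < min n m),
      d i * d ⟨(i : ℕ) + 1, h⟩ = d ⟨(i : ℕ) + 1, h⟩)
    (hchain' : ∀ (i : Fin (min n m)) (h : (i : ℕ) + 1 < min n m),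
      d' i * d' ⟨(i : ℕ) + 1, h⟩ = d' ⟨(i : ℕ) + 1, h⟩)
    (D D' : Matrix (Fin n) (Fin m) R)
    (hD : ∀ (i : Fin n) (j : Fin m),
      D i j = if h : (i : ℕ) = (j : ℕ) then d ⟨(i : ℕ), lt_min i.isLt (h ▸ j.isLt)⟩ else 0)
    (hD' : ∀ (i : Fin n) (j : Fin m),
      D' i j = if h : (i : ℕ) = (j : ℕ) then d' ⟨(i : ℕ), lt_min i.isLt (h ▸ j.isLt)⟩ else 0)
    (P : Matrix (Fin n) (Fin n) R) (Q : Matrix (Fin m) (Fin m) R) (hPQ : D' = P * D * Q)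
    (k : Fin (min n m)) : d' k * d k = d' k := by
  have hn : (k : ℕ) + 1 ≤ n := (lt_min_iff.1 k.isLt).1
  have hm : (k : ℕ) + 1 ≤ m := (lt_min_iff.1 k.isLt).2
  set e := d' k * (1 - d k) with he
  have hek : e * d k = 0 := by
    rw [he, mul_assoc, sub_mul, one_mul, (hidem k).eq, sub_self, mul_zero]
  have he_idem : IsIdempotentElem e := (hidem' k).mul (hidem k).one_sub
  have hed (i : Fin (min n m)) (hi : k ≤ i) : e * d i = 0 := by
    rw [← mul_eq_right_of_idempotent_chain d hidem hchain hi, ← mul_assoc, hek, zero_mul]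
  have hed' (i : Fin (min n m)) (hi : i ≤ k) : e * d' i = e := by
    have h := mul_eq_right_of_idempotent_chain d' hidem' hchain' hi
    rw [he, mul_right_comm, mul_comm (d' k), h]
  let E : Matrix (Fin n) (Fin (k + 1)) R := .of fun i j =>
    if (i : ℕ) = j then e * d ⟨j, by lia⟩ else 0
  let F : Matrix (Fin (k + 1)) (Fin m) R := .of fun i j => if (i : ℕ) = j then 1 else 0
  have hEF : E * F = e • D := by
    ext i j
    simp only [Matrix.mul_apply, Matrix.of_apply, Matrix.smul_apply, smul_eq_mul, hD, E, F]
    by_cases hjk : (j : ℕ) < k + 1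
    · rw [Finset.sum_eq_single ⟨j, hjk⟩]
      · by_cases hij : (i : ℕ) = j <;> simp [hij]
      · intro b _ hb
        rw [if_neg (c := (b : ℕ) = j) (fun h => hb (Fin.ext h)), mul_zero]
      · simp
    · rw [Finset.sum_eq_zero]
      · split_ifs with hij
        · exact (hed _ (Fin.le_def.2 (by simp only; lia))).symm
        · simp
      · intro b _
        rw [if_neg (c := (b : ℕ) = j) (by lia), mul_zero]
  have hmul : (P * E).submatrix (Fin.castLE hn) id * (F * Q).submatrix id (Fin.castLE hm)
      = e • (1 : Matrix (Fin (k + 1)) (Fin (k + 1)) R) := by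
    rw [← Matrix.submatrix_mul _ _ _ _ _ Function.bijective_id]
    have : P * E * (F * Q) = e • D' := by
      rw [hPQ, Matrix.mul_assoc, ← Matrix.mul_assoc E, hEF]
      simp [Matrix.mul_assoc]
    rw [this]
    ext i j
    simp only [Matrix.submatrix_apply, Matrix.smul_apply, smul_eq_mul, hD', Matrix.one_apply,
      Fin.val_castLE, Fin.ext_iff]
    split_ifs with hij
    · rw [mul_one]
      exact hed' _ (Fin.le_def.2 (by simp only; lia))
    · rfl
  have hdet : ((P * E).submatrix (Fin.castLE hn) id).det = 0 := by
    refine Matrix.det_eq_zero_of_column_eq_zero (Fin.last k) fun i => ?_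
    simp [Matrix.mul_apply, E, hek]
  have hzero : e = 0 := by
    have h := congrArg Matrix.det hmul
    rw [Matrix.det_mul, hdet, zero_mul, Matrix.det_smul, Matrix.det_one, mul_one,
      Fintype.card_fin, he_idem.pow_succ_eq] at h
    exact h.symm
  rw [he, mul_sub, mul_one, sub_eq_zero] at hzero
  exact hzero.symm

/-- if two diagonal `n × m` matrices whose diagonal entries are
divisibility chains `d₁ | … | d_p`, `d'₁ | … | d'_p` of idempotents
(`p = min(n,m)`) are equivalent over `R`, then `dᵢ = d'ᵢ` for all `i`.
In particular an ideal of `R` cannot be generated by two distinct idempotents. -/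
theorem equivalent_idempotent_diagonal_unique
    {R : Type*} [CommRing R] {n m : ℕ}
    (d d' : Fin (min n m) → R)
    (hidem : ∀ i, IsIdempotentElem (d i))
    (hidem' : ∀ i, IsIdempotentElem (d' i))
    (hchain : ∀ (i : Fin (min n m)) (h : (i : ℕ) + 1 < min n m),
      d i * d ⟨(i : ℕ) + 1, h⟩ = d ⟨(i : ℕ) + 1, h⟩)
    (hchain' : ∀ (i : Fin (min n m)) (h : (i : ℕ) + 1 < min n m),
      d' i * d' ⟨(i : ℕ) + 1, h⟩ = d' ⟨(i : ℕ) + 1, h⟩)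
    (D D' : Matrix (Fin n) (Fin m) R)
    (hD : ∀ (i : Fin n) (j : Fin m),
      D i j = if h : (i : ℕ) = (j : ℕ) then d ⟨(i : ℕ), lt_min i.isLt (h ▸ j.isLt)⟩ else 0)
    (hD' : ∀ (i : Fin n) (j : Fin m),
      D' i j = if h : (i : ℕ) = (j : ℕ) then d' ⟨(i : ℕ), lt_min i.isLt (h ▸ j.isLt)⟩ else 0)
    (hequiv : MatrixEquivRel R D D') :
    (∀ i, d i = d' i) ∧
    (∀ e f : R, IsIdempotentElem e → IsIdempotentElem f →
      Ideal.span {e} = Ideal.span {f} → e = f) := by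
  refine ⟨fun i => ?_, fun e f he hf hef => ?_⟩
  · obtain ⟨P', Q', hPQ'⟩ := hequiv.symm
    obtain ⟨P, Q, hPQ⟩ := hequiv
    rw [← mul_eq_left_of_eq_mul_idempotent_diagonal_mul d d' hidem hidem' hchain hchain' D D'
      hD hD' P Q hPQ i, mul_comm]
    exact (mul_eq_left_of_eq_mul_idempotent_diagonal_mul d' d hidem' hidem hchain' hchain D' D
      hD' hD P' Q' hPQ' i).symm
  · obtain ⟨a, ha⟩ := Ideal.mem_span_singleton'.1 (hef ▸ Ideal.mem_span_singleton_self e)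
    obtain ⟨b, hb⟩ := Ideal.mem_span_singleton'.1 (hef ▸ Ideal.mem_span_singleton_self f)
    calc e = e * f := by rw [← ha, mul_assoc, hf.eq]
      _ = f := by rw [mul_comm, ← hb, mul_assoc, he.eq]
end

section
/- Let Σ = (A,B) be a system of size (n,m), with B ≠ 0, over a commutative von Neumann regular ring R. Then there exists a finite family e_1,…,e_K of pairwise orthogonal idempotents of R with e_1 + … + e_K = 1 such that for each k, the system (e_k A, e_k B) over the ring e_kR (equivalently, the image of (A,B) in R/(1−e_k)R) is feedback equivalent to a system in strong Kalman decomposition, i.e., of block form ( [[Â_k, 0],[0, Ĉ_k]], [[B̂_k],[0]] ), where the pair (Â_k, B̂_k) is reachable and in Brunovski form over e_kR. -/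
open Matrix

/-- The canonical identification `Fin p ⊕ Fin (n - p) ≃ Fin n` for `p ≤ n`. -/
def splitEquiv (n p : ℕ) (hp : p ≤ n) : Fin p ⊕ Fin (n - p) ≃ Fin n :=
  finSumFinEquiv.trans (finCongr (Nat.add_sub_cancel' hp))

/-- Adding one state in front of each of the chains of lengths `κ`. -/
def sigmaSuccEquiv {ι σ τ : Type*} (κ : ι → ℕ) :
    ι ⊕ ((Σ j, Fin (κ j)) ⊕ τ) ≃
      (Σ j : ι ⊕ σ, Fin (Sum.elim (fun i => κ i + 1) (fun _ => 0) j)) ⊕ τ where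
  toFun
    | .inl j => .inl ⟨.inl j, (0 : Fin (κ j + 1))⟩
    | .inr (.inl ⟨j, i⟩) => .inl ⟨.inl j, (i.succ : Fin (κ j + 1))⟩
    | .inr (.inr t) => .inr t
  invFun
    | .inl ⟨.inl j, i⟩ =>
      Fin.cases (motive := fun _ => ι ⊕ ((Σ j, Fin (κ j)) ⊕ τ)) (.inl j)
        (fun i => .inr (.inl ⟨j, i⟩)) (show Fin (κ j + 1) from i)
    | .inl ⟨.inr _, i⟩ => Fin.elim0 i
    | .inr t => .inr (.inr t)
  left_inv := by
    rintro (j | ⟨j, i⟩ | t) <;> rfl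
  right_inv := by
    rintro (⟨j | j, i⟩ | t)
    · change Fin (κ j + 1) at i
      induction i using Fin.cases <;> rfl
    · exact Fin.elim0 i
    · rfl

open Module in
/-- After a state feedback, the state space splits into chains generated by the images of a basis
of the input space and an invariant complement. -/
theorem exists_basis_chains.{u, v} {F : Type v} [Field F] (d : ℕ) :
    ∀ {U V : Type u} [AddCommGroup U] [Module F U] [FiniteDimensional F U]
      [AddCommGroup V] [Module F V] [FiniteDimensional F V]
      (A : V →ₗ[F] V) (B : U →ₗ[F] V), finrank F V = d →
    ∃ (ι τ : Type) (_ : Fintype ι) (_ : Fintype τ) (κ : ι → ℕ) (u : Basis ι F U)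
      (K : V →ₗ[F] U) (b : Basis ((Σ j, Fin (κ j)) ⊕ τ) F V) (c : τ → τ → F),
      (∀ x : Σ j, Fin (κ j), b (.inl x) = ((A + B ∘ₗ K) ^ (x.2 : ℕ)) (B (u x.1))) ∧
      (∀ j, ((A + B ∘ₗ K) ^ κ j) (B (u j)) = 0) ∧
      ∀ t, (A + B ∘ₗ K) (b (.inr t)) = ∑ s, c t s • b (.inr s) := by
  induction d using Nat.strong_induction_on with
  | _ d ih =>
    intro U V _ _ _ _ _ _ A B hd
    by_cases hB : B = 0
    · subst hB
      let b := finBasis F V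
      have : IsEmpty (Σ j : Fin (finrank F U), Fin ((fun _ => 0 : Fin (finrank F U) → ℕ) j)) :=
        ⟨fun x => Fin.elim0 x.2⟩
      refine ⟨Fin (finrank F U), Fin (finrank F V), inferInstance, inferInstance, fun _ => 0,
        finBasis F U, 0, b.reindex (Equiv.emptySum _ _).symm,
        fun t s => b.repr (A (b t)) s, isEmptyElim, fun j => by simp, fun t => ?_⟩
      simp
    have hlt : finrank F (V ⧸ LinearMap.range B) < d := by
      have h1 := Submodule.finrank_quotient_add_finrank (LinearMap.range B)
      have h2 : 0 < finrank F (LinearMap.range B) := by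
        rw [Nat.pos_iff_ne_zero, Ne, Submodule.finrank_eq_zero, LinearMap.range_eq_bot]
        exact hB
      omega
    set W := LinearMap.range B with hW
    obtain ⟨s, hs⟩ := LinearMap.exists_rightInverse_of_surjective W.mkQ W.range_mkQ
    obtain ⟨ι, τ, _, _, κ, u, K, b, c, hb, hκ, hc⟩ :=
      ih _ hlt (W.mkQ ∘ₗ A ∘ₗ s) (W.mkQ ∘ₗ A ∘ₗ W.subtype) rfl
    set φ : (V ⧸ W) →ₗ[F] V := s + W.subtype ∘ₗ K with hφ
    have hπφ : ∀ y, W.mkQ (φ y) = y := fun y => by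
      have h := LinearMap.congr_fun hs y
      have h2 : W.mkQ (K y : V) = 0 := by simp
      simp only [LinearMap.comp_apply, LinearMap.id_apply] at h
      simp only [hφ, LinearMap.add_apply, LinearMap.comp_apply, Submodule.subtype_apply, map_add,
        h, h2, add_zero]
    set T₁ := W.mkQ ∘ₗ A ∘ₗ s + (W.mkQ ∘ₗ A ∘ₗ W.subtype) ∘ₗ K with hT₁
    have hT₁' : ∀ y, T₁ y = W.mkQ (A (φ y)) := fun y => by simp [hT₁, hφ]
    set T : V →ₗ[F] V := φ ∘ₗ W.mkQ ∘ₗ A with hT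
    obtain ⟨L, hL⟩ := Module.projective_lifting_property B.rangeRestrict
      (LinearMap.codRestrict W (T - A) fun v => by
        rw [← Submodule.Quotient.mk_eq_zero, ← Submodule.mkQ_apply]
        simp only [hT, LinearMap.sub_apply, LinearMap.comp_apply, map_sub, hπφ, sub_self])
      B.surjective_rangeRestrict
    have hTL : A + B ∘ₗ L = T := by
      ext v
      have h := congrArg Subtype.val (LinearMap.congr_fun hL v)
      simp only [LinearMap.comp_apply, LinearMap.codRestrict_apply, LinearMap.sub_apply] at h
      change B (L v) = _ at h
      simp [h]
    have hTφ : ∀ (i : ℕ) y, (T ^ i) (φ y) = φ ((T₁ ^ i) y) := fun i => by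
      induction i with
      | zero => simp
      | succ i ih =>
        intro y
        rw [pow_succ, pow_succ, Module.End.mul_apply, Module.End.mul_apply, ← ih, hT₁']
        rfl
    have hTs : ∀ (i : ℕ) x, (T ^ (i + 1)) x = φ ((T₁ ^ i) (W.mkQ (A x))) := fun i x => by
      rw [pow_succ, Module.End.mul_apply, ← hTφ]
      rfl
    obtain ⟨g, hg⟩ := LinearMap.exists_rightInverse_of_surjective B.rangeRestrict
      B.range_rangeRestrict
    have hBg : ∀ x, B (g x) = x := fun x => by
      have h := congrArg Subtype.val (LinearMap.congr_fun hg x)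
      simpa using h
    let eU : (W × LinearMap.ker B) ≃ₗ[F] U :=
      LinearEquiv.ofBijective (g.coprod (LinearMap.ker B).subtype) <| by
        refine ⟨(injective_iff_map_eq_zero _).2 ?_, fun y => ?_⟩
        · rintro ⟨x, y⟩ h
          simp only [LinearMap.coprod_apply, Submodule.subtype_apply] at h
          have hx : x = 0 := by
            have h' := congrArg B h
            rw [map_add, hBg, y.2, add_zero, map_zero] at h'
            exact Subtype.ext h'
          subst hx
          simpa using h
        · refine ⟨(B.rangeRestrict y, ⟨y - g (B.rangeRestrict y), ?_⟩), by simp⟩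
          rw [LinearMap.mem_ker, map_sub, hBg]
          simp
    let eV : (W × (V ⧸ W)) ≃ₗ[F] V :=
      LinearEquiv.ofBijective (W.subtype.coprod φ) <| by
        refine ⟨(injective_iff_map_eq_zero _).2 ?_, fun y => ?_⟩
        · rintro ⟨x, y⟩ h
          simp only [LinearMap.coprod_apply, Submodule.subtype_apply] at h
          have hy : y = 0 := by
            have h' := congrArg W.mkQ h
            rw [map_add, hπφ, map_zero, Submodule.mkQ_apply,
              (Submodule.Quotient.mk_eq_zero W).2 x.2, zero_add] at h'
            exact h'
          subst hy
          simpa using h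
        · refine ⟨(⟨y - φ (W.mkQ y), ?_⟩, W.mkQ y), by simp⟩
          rw [← Submodule.Quotient.mk_eq_zero, ← Submodule.mkQ_apply, map_sub, hπφ, sub_self]
    have heU : ∀ z, eU z = g z.1 + z.2 := fun z => rfl
    have heV : ∀ z, eV z = z.1 + φ z.2 := fun z => rfl
    let u' := (u.prod (finBasis F (LinearMap.ker B))).map eU
    let b' := ((u.prod b).map eV).reindex
      (sigmaSuccEquiv (σ := Fin (finrank F (LinearMap.ker B))) κ)
    have hb' : ∀ x, b' (sigmaSuccEquiv κ x) = eV ((u.prod b) x) := fun x => by simp [b']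
    have hu'l : ∀ j, B (u' (.inl j)) = u j := fun j => by
      simp [u', Basis.prod_apply, heU, hBg]
    have hu'r : ∀ j, B (u' (.inr j)) = 0 := fun j => by
      simp [u', Basis.prod_apply, heU]
    refine ⟨_, τ, inferInstance, inferInstance, _, u', L, b', c, ?_, ?_, ?_⟩
    · rw [hTL]
      rintro ⟨j | j, i⟩
      · rw [hu'l]
        change Fin (κ j + 1) at i
        induction i using Fin.cases with
        | zero =>
          refine (hb' (.inl j)).trans ?_
          simp [Basis.prod_apply, heV]
        | succ i =>
          refine (hb' (.inr (.inl ⟨j, i⟩))).trans (Eq.trans ?_ (hTs i _).symm)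
          simp [Basis.prod_apply, heV, hb]
      · exact Fin.elim0 i
    · rw [hTL]
      rintro (j | j)
      · rw [hu'l]
        change (T ^ (κ j + 1)) (u j) = 0
        rw [hTs]
        have := hκ j
        simp only [LinearMap.comp_apply, Submodule.subtype_apply] at this
        rw [this, map_zero]
      · rw [hu'r, map_zero]
    · intro t
      have hb'r : ∀ t, b' (.inr t) = φ (b (.inr t)) := fun t => by
        refine (hb' (.inr (.inr t))).trans ?_
        simp [Basis.prod_apply, heV]
      rw [hTL, hb'r, ← pow_one T, hTφ, pow_one, hc]
      simp [hb'r]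

/-- The state matrix of the Brunovski form with controllability indices `κ`. -/
def brunovskiState {m : ℕ} (R : Type*) [CommRing R] (p : ℕ) (κ : Fin m → ℕ) :
    Matrix (Fin p) (Fin p) R :=
  .of fun i j => if (i : ℕ) = (j : ℕ) + 1 ∧ ∀ l : Fin m, (i : ℕ) ≠ ∑ k ∈ Finset.Iio l, κ k
    then 1 else 0

/-- The input matrix of the Brunovski form with controllability indices `κ`. -/
def brunovskiInput {m : ℕ} (R : Type*) [CommRing R] (p : ℕ) (κ : Fin m → ℕ) :
    Matrix (Fin p) (Fin m) R :=
  .of fun i j => if (i : ℕ) = ∑ k ∈ Finset.Iio j, κ k ∧ 0 < κ j then 1 else 0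

lemma brunovskiState_map {m p : ℕ} {R S : Type*} [CommRing R] [CommRing S] (f : R →+* S)
    (κ : Fin m → ℕ) : (brunovskiState R p κ).map f = brunovskiState S p κ := by
  ext i j
  simp [brunovskiState, apply_ite f]

lemma brunovskiInput_map {m p : ℕ} {R S : Type*} [CommRing R] [CommRing S] (f : R →+* S)
    (κ : Fin m → ℕ) : (brunovskiInput R p κ).map f = brunovskiInput S p κ := by
  ext i j
  simp [brunovskiInput, apply_ite f]

lemma sigma_fin_ext_iff {ι : Type*} {κ : ι → ℕ} (x y : Σ j, Fin (κ j)) :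
    x = y ↔ x.1 = y.1 ∧ (x.2 : ℕ) = y.2 := by
  refine ⟨by rintro rfl; exact ⟨rfl, rfl⟩, ?_⟩
  obtain ⟨j, i⟩ := x
  obtain ⟨l, k⟩ := y
  rintro ⟨rfl, h⟩
  exact congrArg _ (Fin.ext h)

/-- Position of the `i`-th state of the `j`-th chain. -/
def chainEquiv {m p : ℕ} (κ : Fin m → ℕ) (h : ∑ j, κ j = p) : (Σ j, Fin (κ j)) ≃ Fin p :=
  finSigmaFinEquiv.trans (finCongr h)

lemma chainEquiv_val {m p : ℕ} (κ : Fin m → ℕ) (h : ∑ j, κ j = p) (x : Σ j, Fin (κ j)) :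
    (chainEquiv κ h x : ℕ) = ∑ k ∈ Finset.Iio x.1, κ k + x.2 := by
  change (finSigmaFinEquiv x : ℕ) = _
  rw [finSigmaFinEquiv_apply]
  congr 1
  refine Finset.sum_bij (fun i _ => Fin.castLE x.1.2.le i) (fun i _ => ?_) (fun i _ j _ hij => ?_)
    (fun j hj => ?_) (fun _ _ => rfl)
  · exact Finset.mem_Iio.2 i.2
  · exact Fin.castLE_injective _ hij
  · exact ⟨⟨j, Fin.lt_def.1 (Finset.mem_Iio.1 hj)⟩, Finset.mem_univ _, rfl⟩

lemma brunovskiState_chainEquiv {m p : ℕ} (R : Type*) [CommRing R] (κ : Fin m → ℕ)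
    (h : ∑ j, κ j = p) (x y : Σ j, Fin (κ j)) :
    brunovskiState R p κ (chainEquiv κ h x) (chainEquiv κ h y) =
      if x.1 = y.1 ∧ (x.2 : ℕ) = y.2 + 1 then 1 else 0 := by
  have hadd : ∀ l : Fin m, ∑ k ∈ Finset.Iic l, κ k = ∑ k ∈ Finset.Iio l, κ k + κ l := fun l => by
    rw [← Finset.Iio_insert, Finset.sum_insert (by simp), add_comm]
  refine if_congr ?_ rfl rfl
  rw [chainEquiv_val, chainEquiv_val]
  obtain ⟨j, i⟩ := x
  obtain ⟨j', i'⟩ := y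
  constructor
  · rintro ⟨h1, h2⟩
    have h3 := h2 j
    obtain ⟨i₀, hi₀⟩ : ∃ i₀, (i : ℕ) = i₀ + 1 := Nat.exists_eq_succ_of_ne_zero (by
      rintro hi
      simp [hi] at h3)
    have : (⟨j, ⟨i₀, by omega⟩⟩ : Σ j, Fin (κ j)) = ⟨j', i'⟩ := by
      apply (chainEquiv κ h).injective
      apply Fin.ext
      rw [chainEquiv_val, chainEquiv_val]
      simp only at h1 ⊢
      omega
    obtain ⟨h4, h5⟩ := (sigma_fin_ext_iff _ _).1 this
    simp only at h4 h5
    exact ⟨h4, by simp only; omega⟩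
  · rintro ⟨rfl, h1⟩
    simp only at h1 ⊢
    refine ⟨by omega, fun l => ?_⟩
    rcases le_or_gt l j with hl | hl
    · have : ∑ k ∈ Finset.Iio l, κ k ≤ ∑ k ∈ Finset.Iio j, κ k :=
        Finset.sum_le_sum_of_subset (Finset.Iio_subset_Iio hl)
      omega
    · have : ∑ k ∈ Finset.Iic j, κ k ≤ ∑ k ∈ Finset.Iio l, κ k :=
        Finset.sum_le_sum_of_subset fun k hk =>
          Finset.mem_Iio.2 ((Finset.mem_Iic.1 hk).trans_lt hl)
      have := hadd j
      have := i.2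
      omega

lemma brunovskiInput_chainEquiv {m p : ℕ} (R : Type*) [CommRing R] (κ : Fin m → ℕ)
    (h : ∑ j, κ j = p) (x : Σ j, Fin (κ j)) (j : Fin m) :
    brunovskiInput R p κ (chainEquiv κ h x) j = if x.1 = j ∧ (x.2 : ℕ) = 0 then 1 else 0 := by
  refine if_congr ?_ rfl rfl
  rw [chainEquiv_val]
  obtain ⟨l, i⟩ := x
  constructor
  · rintro ⟨h1, h2⟩
    have : (⟨l, i⟩ : Σ j, Fin (κ j)) = ⟨j, ⟨0, h2⟩⟩ := by
      apply (chainEquiv κ h).injective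
      apply Fin.ext
      rw [chainEquiv_val, chainEquiv_val]
      simpa using h1
    exact (sigma_fin_ext_iff _ _).1 this
  · rintro ⟨rfl, h1⟩
    simp only at h1 ⊢
    have := i.2
    omega

lemma isBrunovskiForm_brunovski {m p : ℕ} (R : Type*) [CommRing R] {κ : Fin m → ℕ}
    (hκ : Antitone κ) (h : ∑ j, κ j = p) :
    IsBrunovskiForm R (brunovskiState R p κ) (brunovskiInput R p κ) κ :=
  ⟨hκ, h, fun _ _ => rfl, fun _ _ => rfl⟩

lemma brunovskiState_pow_mul_input {m p : ℕ} (R : Type*) [CommRing R] (κ : Fin m → ℕ)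
    (h : ∑ j, κ j = p) (j : Fin m) (i : ℕ) (hi : i < κ j) (y : Fin p) :
    (brunovskiState R p κ ^ i * brunovskiInput R p κ) y j =
      if y = chainEquiv κ h ⟨j, ⟨i, hi⟩⟩ then 1 else 0 := by
  induction i generalizing y with
  | zero =>
    obtain ⟨⟨l, i⟩, rfl⟩ := (chainEquiv κ h).surjective y
    rw [pow_zero, Matrix.one_mul, brunovskiInput_chainEquiv]
    refine if_congr ?_ rfl rfl
    rw [EmbeddingLike.apply_eq_iff_eq, sigma_fin_ext_iff]
  | succ i ih =>
    obtain ⟨⟨l, k⟩, rfl⟩ := (chainEquiv κ h).surjective y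
    rw [pow_succ', Matrix.mul_assoc, Matrix.mul_apply]
    simp only [ih (by omega), mul_ite, mul_one, mul_zero, Finset.sum_ite_eq', Finset.mem_univ,
      if_true]
    rw [brunovskiState_chainEquiv]
    refine if_congr ?_ rfl rfl
    rw [EmbeddingLike.apply_eq_iff_eq, sigma_fin_ext_iff]

lemma sysReachable_brunovski {m p : ℕ} (R : Type*) [CommRing R] (κ : Fin m → ℕ)
    (h : ∑ j, κ j = p) :
    SysReachable R (brunovskiState R p κ) (brunovskiInput R p κ) := by
  rw [SysReachable, Nmod, eq_top_iff, ← (Pi.basisFun R (Fin p)).span_eq, Submodule.span_le]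
  rintro _ ⟨q, rfl⟩
  obtain ⟨⟨j, i⟩, rfl⟩ := (chainEquiv κ h).surjective q
  refine Submodule.subset_span ⟨i, ?_, j, ?_⟩
  · rw [Fintype.card_fin, ← h]
    exact i.2.trans_le (Finset.single_le_sum (f := κ) (fun _ _ => Nat.zero_le _)
      (Finset.mem_univ j))
  · ext y
    rw [brunovskiState_pow_mul_input R κ h j i i.2, Pi.basisFun_apply, Pi.single_apply]

/-- The state matrix of a strong Kalman decomposition with Brunovski reachable part. -/
def strongKalmanState {n m : ℕ} {R : Type*} [CommRing R] (p : ℕ) (hp : p ≤ n) (κ : Fin m → ℕ)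
    (C : Matrix (Fin (n - p)) (Fin (n - p)) R) : Matrix (Fin n) (Fin n) R :=
  Matrix.reindex (splitEquiv n p hp) (splitEquiv n p hp)
    (Matrix.fromBlocks (brunovskiState R p κ) 0 0 C)

/-- The input matrix of a strong Kalman decomposition with Brunovski reachable part. -/
def strongKalmanInput {n m : ℕ} (R : Type*) [CommRing R] (p : ℕ) (hp : p ≤ n) (κ : Fin m → ℕ) :
    Matrix (Fin n) (Fin m) R :=
  Matrix.reindex (splitEquiv n p hp) (Equiv.refl (Fin m))
    (Matrix.fromRows (brunovskiInput R p κ) 0)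

lemma strongKalmanState_map {n m p : ℕ} {R S : Type*} [CommRing R] [CommRing S] (f : R →+* S)
    (hp : p ≤ n) (κ : Fin m → ℕ) (C : Matrix (Fin (n - p)) (Fin (n - p)) R) :
    (strongKalmanState p hp κ C).map f = strongKalmanState p hp κ (C.map f) := by
  rw [strongKalmanState, strongKalmanState, ← brunovskiState_map f]
  ext i j
  obtain ⟨i, rfl⟩ := (splitEquiv n p hp).surjective i
  obtain ⟨j, rfl⟩ := (splitEquiv n p hp).surjective j
  rcases i with i | i <;> rcases j with j | j <;> simp

lemma strongKalmanInput_map {n m p : ℕ} {R S : Type*} [CommRing R] [CommRing S] (f : R →+* S)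
    (hp : p ≤ n) (κ : Fin m → ℕ) :
    (strongKalmanInput R p hp κ).map f = strongKalmanInput S p hp κ := by
  rw [strongKalmanInput, strongKalmanInput, ← brunovskiInput_map f]
  ext i j
  obtain ⟨i, rfl⟩ := (splitEquiv n p hp).surjective i
  rcases i with i | i <;> simp

/-- After multiplication by `e`, the system `(A, B)` becomes feedback equivalent to a strong Kalman
decomposition whose reachable part is in Brunovski form. -/
def DecomposableAt {n m : ℕ} {R : Type*} [CommRing R] (A : Matrix (Fin n) (Fin n) R)
    (B : Matrix (Fin n) (Fin m) R) (e : R) : Prop :=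
  ∃ (p : ℕ) (hp : p ≤ n) (κ : Fin m → ℕ) (C : Matrix (Fin (n - p)) (Fin (n - p)) R)
    (S S' : Matrix (Fin n) (Fin n) R) (Q Q' : Matrix (Fin m) (Fin m) R)
    (K : Matrix (Fin m) (Fin n) R),
    Antitone κ ∧ ∑ j, κ j = p ∧ e • (S * S') = e • 1 ∧ e • (Q * Q') = e • 1 ∧
    e • ((A + B * K) * S) = e • (S * strongKalmanState p hp κ C) ∧
    e • (B * Q) = e • (S * strongKalmanInput R p hp κ)

open Module in
lemma decomposableAt_one_of_field {n m : ℕ} {F : Type*} [Field F] (A : Matrix (Fin n) (Fin n) F)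
    (B : Matrix (Fin n) (Fin m) F) : DecomposableAt A B 1 := by
  classical
  obtain ⟨ι, τ, _, _, κ, u, L, b, c, hb, hκ, hc⟩ :=
    exists_basis_chains _ A.mulVecLin B.mulVecLin rfl
  have hT : ∀ v, (A.mulVecLin + B.mulVecLin ∘ₗ L) v = (A + B * L.toMatrix') *ᵥ v := fun v => by
    simp [Matrix.add_mulVec, ← Matrix.mulVec_mulVec, LinearMap.toMatrix'_mulVec]
  set T := A.mulVecLin + B.mulVecLin ∘ₗ L
  obtain ⟨g, hg⟩ : ∃ g : Fin m ≃ ι, Antitone (κ ∘ g) := by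
    have hι : Fintype.card ι = m := by simpa using (finrank_eq_card_basis u).symm
    let g₀ := (Fintype.equivFinOfCardEq hι).symm
    exact ⟨(Tuple.sort (OrderDual.toDual ∘ κ ∘ g₀)).trans g₀, fun i j hij =>
      Tuple.monotone_sort (OrderDual.toDual ∘ κ ∘ g₀) hij⟩
  obtain ⟨p, hκp⟩ : ∃ p, ∑ j, (κ ∘ g) j = p := ⟨_, rfl⟩
  have hcard : n = p + Fintype.card τ := by
    have h := finrank_eq_card_basis b
    simp only [finrank_fin_fun, Fintype.card_sum, Fintype.card_sigma, Fintype.card_fin] at h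
    rw [h, ← hκp]
    simp only [Function.comp_apply, g.sum_comp]
  have hp : p ≤ n := by omega
  let θ : Fin (n - p) ≃ τ := (Fintype.equivFinOfCardEq (by omega)).symm
  let E : Fin n ≃ (Σ j, Fin (κ j)) ⊕ τ :=
    (splitEquiv n p hp).symm.trans
      (Equiv.sumCongr ((chainEquiv (κ ∘ g) hκp).symm.trans
        (Equiv.sigmaCongrLeft (β := fun j => Fin (κ j)) g)) θ)
  let b' := b.reindex E.symm
  have hbl : ∀ x : Σ j, Fin ((κ ∘ g) j),
      b' (splitEquiv n p hp (.inl (chainEquiv (κ ∘ g) hκp x))) =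
        (T ^ (x.2 : ℕ)) (B *ᵥ (u (g x.1))) := fun x => by
    rw [← Matrix.mulVecLin_apply]
    refine Eq.trans ?_ (hb ⟨g x.1, x.2⟩)
    have hE : E (splitEquiv n p hp (.inl (chainEquiv (κ ∘ g) hκp x))) =
        .inl (Equiv.sigmaCongrLeft (β := fun j => Fin (κ j)) g
          ((chainEquiv (κ ∘ g) hκp).symm (chainEquiv (κ ∘ g) hκp x))) := by
      simp [E]
    rw [Equiv.symm_apply_apply] at hE
    rw [Basis.reindex_apply, Equiv.symm_symm, hE]
    rfl
  have hbr : ∀ t, b' (splitEquiv n p hp (.inr t)) = b (.inr (θ t)) := fun t => by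
    simp [b', E]
  let u' := u.reindex g.symm
  refine ⟨p, hp, κ ∘ g, .of fun s t => c (θ t) (θ s), (Pi.basisFun F _).toMatrix b',
    b'.toMatrix (Pi.basisFun F _), (Pi.basisFun F _).toMatrix u', u'.toMatrix (Pi.basisFun F _),
    L.toMatrix', hg, hκp, ?_, ?_, ?_, ?_⟩
  · rw [Basis.toMatrix_mul_toMatrix_flip]
  · rw [Basis.toMatrix_mul_toMatrix_flip]
  · rw [one_smul, one_smul]
    ext i q
    obtain ⟨q, rfl⟩ := (splitEquiv n p hp).surjective q
    have hl : ((A + B * L.toMatrix') * (Pi.basisFun F _).toMatrix b') i (splitEquiv n p hp q) =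
        T (b' (splitEquiv n p hp q)) i := by
      rw [hT]
      rfl
    rw [hl, Matrix.mul_apply, ← (splitEquiv n p hp).sum_comp, Fintype.sum_sum_type]
    simp only [strongKalmanState, Matrix.reindex_apply, Matrix.submatrix_apply,
      Equiv.symm_apply_apply, Basis.toMatrix_apply, Pi.basisFun_repr]
    rcases q with q | q
    · obtain ⟨⟨j, k⟩, rfl⟩ := (chainEquiv (κ ∘ g) hκp).surjective q
      simp only [Matrix.fromBlocks_apply₁₁, Matrix.fromBlocks_apply₂₁, Matrix.zero_apply, mul_zero,
        Finset.sum_const_zero, add_zero]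
      rw [← (chainEquiv (κ ∘ g) hκp).sum_comp]
      simp only [brunovskiState_chainEquiv]
      rw [hbl, ← Module.End.mul_apply, ← pow_succ']
      by_cases hk : (k : ℕ) + 1 < (κ ∘ g) j
      · rw [Finset.sum_eq_single ⟨j, ⟨k + 1, hk⟩⟩]
        · simp [hbl]
        · intro x _ hx
          rw [if_neg fun h => hx ((sigma_fin_ext_iff _ _).2 h), mul_zero]
        · simp
      · rw [Finset.sum_eq_zero]
        · have hk' : (k : ℕ) + 1 = κ (g j) := le_antisymm k.2 (not_lt.1 hk)
          simp only [hk']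
          have := hκ (g j)
          rw [Matrix.mulVecLin_apply] at this
          rw [this, Pi.zero_apply]
        · rintro ⟨j', k'⟩ _
          rw [if_neg, mul_zero]
          rintro ⟨rfl, h⟩
          simp only at h
          exact hk (h ▸ k'.2)
    · simp only [Matrix.fromBlocks_apply₁₂, Matrix.fromBlocks_apply₂₂, Matrix.zero_apply, mul_zero,
        Finset.sum_const_zero, zero_add]
      rw [hbr, hc, ← θ.sum_comp]
      simp [hbr, mul_comm]
  · rw [one_smul, one_smul]
    ext i j
    have hl : (B * (Pi.basisFun F _).toMatrix u') i j = (B *ᵥ u (g j)) i := by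
      have : u (g j) = u' j := by simp [u']
      rw [this]
      rfl
    rw [hl, Matrix.mul_apply, ← (splitEquiv n p hp).sum_comp, Fintype.sum_sum_type]
    simp only [strongKalmanInput, Matrix.reindex_apply, Matrix.submatrix_apply,
      Equiv.symm_apply_apply, Basis.toMatrix_apply, Pi.basisFun_repr, Equiv.refl_symm,
      Equiv.refl_apply, Matrix.fromRows_apply_inl, Matrix.fromRows_apply_inr, Matrix.zero_apply,
      mul_zero, Finset.sum_const_zero, add_zero]
    rw [← (chainEquiv (κ ∘ g) hκp).sum_comp]
    simp only [brunovskiInput_chainEquiv]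
    by_cases hk : 0 < (κ ∘ g) j
    · rw [Finset.sum_eq_single ⟨j, ⟨0, hk⟩⟩]
      · simp [hbl]
      · intro x _ hx
        rw [if_neg fun h => hx ((sigma_fin_ext_iff _ _).2 h), mul_zero]
      · simp
    · rw [Finset.sum_eq_zero]
      · have hk' : κ (g j) = 0 := by simpa using hk
        have := hκ (g j)
        rw [hk', Matrix.mulVecLin_apply, pow_zero, Module.End.one_apply] at this
        rw [this, Pi.zero_apply]
      · rintro ⟨j', k'⟩ _
        rw [if_neg, mul_zero]
        rintro ⟨rfl, h⟩
        exact hk k'.pos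

lemma exists_isIdempotentElem_notMem_mul_eq_zero {R : Type*} [CommRing R]
    (hreg : ∀ a : R, ∃ x : R, a ^ 2 * x = a) (M : Ideal R) [M.IsPrime] {ι : Type*} (s : Finset ι)
    (a : ι → R) (ha : ∀ i ∈ s, a i ∈ M) :
    ∃ e : R, IsIdempotentElem e ∧ e ∉ M ∧ ∀ i ∈ s, e * a i = 0 := by
  classical
  choose x hx using hreg
  refine ⟨∏ i ∈ s, (1 - a i * x (a i)), ?_, ?_, fun i hi => ?_⟩
  · rw [IsIdempotentElem, ← Finset.prod_mul_distrib]
    refine Finset.prod_congr rfl fun i _ => ?_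
    linear_combination x (a i) * hx (a i)
  · rw [Ideal.IsPrime.prod_mem_iff]
    rintro ⟨i, hi, h⟩
    refine (Ideal.ne_top_iff_one M).1 ‹M.IsPrime›.ne_top ?_
    simpa using M.add_mem h (M.mul_mem_right (x (a i)) (ha i hi))
  · rw [← Finset.mul_prod_erase s _ hi]
    linear_combination -(∏ j ∈ s.erase i, (1 - a j * x (a j))) * hx (a i)

lemma exists_isIdempotentElem_notMem_smul_eq {R : Type*} [CommRing R]
    (hreg : ∀ a : R, ∃ x : R, a ^ 2 * x = a) (M : Ideal R) [M.IsPrime] {ι κ : Type*} [Fintype ι]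
    [Fintype κ] {X Y : Matrix ι κ R}
    (h : X.map (Ideal.Quotient.mk M) = Y.map (Ideal.Quotient.mk M)) :
    ∃ e : R, IsIdempotentElem e ∧ e ∉ M ∧ e • X = e • Y := by
  obtain ⟨e, he, heM, h⟩ := exists_isIdempotentElem_notMem_mul_eq_zero hreg M Finset.univ
    (fun i : ι × κ => X i.1 i.2 - Y i.1 i.2) fun i _ => by
      rw [← Ideal.Quotient.eq]
      exact congrFun (congrFun h i.1) i.2
  refine ⟨e, he, heM, ?_⟩
  ext i j
  simpa [mul_sub, sub_eq_zero] using h (i, j) (Finset.mem_univ _)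

lemma smul_eq_smul_of_dvd {R M : Type*} [CommRing R] [AddCommGroup M] [Module R M] {e f : R}
    {x y : M} (hef : e ∣ f) (h : e • x = e • y) : f • x = f • y := by
  obtain ⟨g, rfl⟩ := hef
  rw [mul_comm, mul_smul, h, mul_smul]

lemma exists_decomposableAt_notMem {n m : ℕ} {R : Type*} [CommRing R]
    (hreg : ∀ a : R, ∃ x : R, a ^ 2 * x = a) (A : Matrix (Fin n) (Fin n) R)
    (B : Matrix (Fin n) (Fin m) R) (M : Ideal R) [M.IsMaximal] :
    ∃ e : R, IsIdempotentElem e ∧ e ∉ M ∧ DecomposableAt A B e := by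
  let := Ideal.Quotient.field M
  obtain ⟨p, hp, κ, C, S, S', Q, Q', K, hκ, hκp, h1, h2, h3, h4⟩ :=
    decomposableAt_one_of_field (A.map (Ideal.Quotient.mk M)) (B.map (Ideal.Quotient.mk M))
  have hlift : ∀ {k l : ℕ} (X : Matrix (Fin k) (Fin l) (R ⧸ M)),
      ∃ Y : Matrix (Fin k) (Fin l) R, Y.map (Ideal.Quotient.mk M) = X := fun X =>
    ⟨X.map (Function.surjInv Ideal.Quotient.mk_surjective), by
      ext i j
      simp [Function.surjInv_eq]⟩
  obtain ⟨C, rfl⟩ := hlift C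
  obtain ⟨S, rfl⟩ := hlift S
  obtain ⟨S', rfl⟩ := hlift S'
  obtain ⟨Q, rfl⟩ := hlift Q
  obtain ⟨Q', rfl⟩ := hlift Q'
  obtain ⟨K, rfl⟩ := hlift K
  simp only [one_smul] at h1 h2 h3 h4
  obtain ⟨e₁, he₁, hM₁, h1⟩ := exists_isIdempotentElem_notMem_smul_eq hreg M
    (X := S * S') (Y := 1) (by simpa [Matrix.map_mul] using h1)
  obtain ⟨e₂, he₂, hM₂, h2⟩ := exists_isIdempotentElem_notMem_smul_eq hreg M
    (X := Q * Q') (Y := 1) (by simpa [Matrix.map_mul] using h2)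
  obtain ⟨e₃, he₃, hM₃, h3⟩ := exists_isIdempotentElem_notMem_smul_eq hreg M
    (X := (A + B * K) * S) (Y := S * strongKalmanState p hp κ C) (by
      rw [Matrix.map_mul, Matrix.map_mul, strongKalmanState_map, Matrix.map_add _ (map_add _),
        Matrix.map_mul]
      exact h3)
  obtain ⟨e₄, he₄, hM₄, h4⟩ := exists_isIdempotentElem_notMem_smul_eq hreg M
    (X := B * Q) (Y := S * strongKalmanInput R p hp κ) (by
      rw [Matrix.map_mul, Matrix.map_mul, strongKalmanInput_map]
      exact h4)
  have hM : M.IsPrime := inferInstance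
  refine ⟨e₁ * e₂ * (e₃ * e₄), (he₁.mul he₂).mul (he₃.mul he₄),
    hM.mul_notMem (hM.mul_notMem hM₁ hM₂) (hM.mul_notMem hM₃ hM₄),
    p, hp, κ, C, S, S', Q, Q', K, hκ, hκp, ?_, ?_, ?_, ?_⟩
  · exact smul_eq_smul_of_dvd ⟨e₂ * e₃ * e₄, by ring⟩ h1
  · exact smul_eq_smul_of_dvd ⟨e₁ * e₃ * e₄, by ring⟩ h2
  · exact smul_eq_smul_of_dvd ⟨e₁ * e₂ * e₄, by ring⟩ h3
  · exact smul_eq_smul_of_dvd ⟨e₁ * e₂ * e₃, by ring⟩ h4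

lemma DecomposableAt.mul_left {n m : ℕ} {R : Type*} [CommRing R] {A : Matrix (Fin n) (Fin n) R}
    {B : Matrix (Fin n) (Fin m) R} {e : R} (h : DecomposableAt A B e) (f : R) :
    DecomposableAt A B (f * e) := by
  obtain ⟨p, hp, κ, C, S, S', Q, Q', K, hκ, hκp, h1, h2, h3, h4⟩ := h
  exact ⟨p, hp, κ, C, S, S', Q, Q', K, hκ, hκp,
    smul_eq_smul_of_dvd (dvd_mul_left e f) h1, smul_eq_smul_of_dvd (dvd_mul_left e f) h2,
    smul_eq_smul_of_dvd (dvd_mul_left e f) h3, smul_eq_smul_of_dvd (dvd_mul_left e f) h4⟩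

/-- A finite family of idempotents with a property inherited by multiples can be refined to an
orthogonal one. -/
lemma exists_orthogonalIdempotents_sum_eq {R : Type*} [CommRing R] (P : R → Prop)
    (hP : ∀ e f, P e → P (f * e)) (s : Finset R) (hs : ∀ e ∈ s, IsIdempotentElem e ∧ P e) :
    ∃ (I : Type) (_ : Fintype I) (e : I → R), OrthogonalIdempotents e ∧ (∀ i, P (e i)) ∧
      ∑ i, e i = 1 - ∏ x ∈ s, (1 - x) := by
  classical
  induction s using Finset.induction_on with
  | empty => exact ⟨Empty, inferInstance, Empty.elim, ⟨isEmptyElim, fun i => i.elim⟩, isEmptyElim,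
      by simp⟩
  | insert x s hx ih =>
    obtain ⟨I, _, e, he, hPe, hsum⟩ := ih fun e h => hs e (Finset.mem_insert_of_mem h)
    obtain ⟨hxi, hPx⟩ := hs x (Finset.mem_insert_self _ _)
    have hσ : IsIdempotentElem (∑ i, e i) := he.isIdempotentElem_sum
    have h0 : (1 - ∑ i, e i) * x * ∑ i, e i = 0 := by
      linear_combination -x * hσ.eq
    refine ⟨Option I, inferInstance, _,
      he.option ((1 - ∑ i, e i) * x) (hσ.one_sub.mul hxi) h0 (by rw [mul_comm, h0]), ?_, ?_⟩
    · rintro (_ | i)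
      · exact hP _ _ hPx
      · exact hPe i
    · rw [Fintype.sum_option, Finset.prod_insert hx]
      simp only [Option.elim]
      linear_combination (1 - x) * hsum

lemma exists_completeOrthogonalIdempotents {R : Type*} [CommRing R] (P : R → Prop)
    (hP : ∀ e f, P e → P (f * e))
    (hloc : ∀ M : Ideal R, M.IsMaximal → ∃ e, IsIdempotentElem e ∧ e ∉ M ∧ P e) :
    ∃ (K : ℕ) (e : Fin K → R), CompleteOrthogonalIdempotents e ∧ ∀ k, P (e k) := by
  classical
  have htop : Ideal.span {e : R | IsIdempotentElem e ∧ P e} = ⊤ := by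
    by_contra h
    obtain ⟨M, hM, hle⟩ := Ideal.exists_le_maximal _ h
    obtain ⟨e, he, heM, hPe⟩ := hloc M hM
    exact heM (hle (Ideal.subset_span ⟨he, hPe⟩))
  obtain ⟨s, hs, h1⟩ := Submodule.mem_span_finite_of_mem_span ((Ideal.eq_top_iff_one _).1 htop)
  obtain ⟨I, _, e, he, hPe, hsum⟩ := exists_orthogonalIdempotents_sum_eq P hP s fun e h => hs h
  have hzero : ∀ y ∈ Submodule.span R (s : Set R), y * ∏ x ∈ s, (1 - x) = 0 := fun y hy => by
    induction hy using Submodule.span_induction with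
    | mem x hx =>
      rw [← Finset.mul_prod_erase s _ hx, ← mul_assoc, mul_sub, mul_one, (hs hx).1.eq, sub_self,
        zero_mul]
    | zero => rw [zero_mul]
    | add x y _ _ hx hy => rw [add_mul, hx, hy, add_zero]
    | smul r x _ hx => rw [smul_mul_assoc, hx, smul_zero]
  have h := hzero 1 h1
  rw [one_mul] at h
  rw [h, sub_zero] at hsum
  let g := (Fintype.equivFin I).symm
  refine ⟨_, e ∘ g, ⟨(OrthogonalIdempotents.equiv g).2 he, ?_⟩, fun k => hPe _⟩
  rw [← hsum]
  exact g.sum_comp e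

lemma DecomposableAt.quotient {n m : ℕ} {R : Type*} [CommRing R] {A : Matrix (Fin n) (Fin n) R}
    {B : Matrix (Fin n) (Fin m) R} {e : R} (h : DecomposableAt A B e) :
    ∃ (p : ℕ) (hp : p ≤ n)
      (Ahat : Matrix (Fin p) (Fin p) (R ⧸ Ideal.span {1 - e}))
      (Bhat : Matrix (Fin p) (Fin m) (R ⧸ Ideal.span {1 - e}))
      (Chat : Matrix (Fin (n - p)) (Fin (n - p)) (R ⧸ Ideal.span {1 - e}))
      (κ : Fin m → ℕ),
      SysReachable (R ⧸ Ideal.span {1 - e}) Ahat Bhat ∧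
      IsBrunovskiForm (R ⧸ Ideal.span {1 - e}) Ahat Bhat κ ∧
      FeedbackEquiv (R ⧸ Ideal.span {1 - e})
        (A.map (Ideal.Quotient.mk (Ideal.span {1 - e})))
        (B.map (Ideal.Quotient.mk (Ideal.span {1 - e})))
        ((Matrix.reindex (splitEquiv n p hp) (splitEquiv n p hp))
          (Matrix.fromBlocks Ahat 0 0 Chat))
        ((Matrix.reindex (splitEquiv n p hp) (Equiv.refl (Fin m)))
          (Matrix.fromRows Bhat 0)) := by
  obtain ⟨p, hp, κ, C, S, S', Q, Q', K, hκ, hκp, h1, h2, h3, h4⟩ := h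
  set π := Ideal.Quotient.mk (Ideal.span {1 - e}) with hπ
  have he : π e = 1 := by
    rw [← map_one π, eq_comm, hπ, Ideal.Quotient.eq]
    exact Ideal.mem_span_singleton_self _
  have hmap : ∀ {k l : ℕ} {X Y : Matrix (Fin k) (Fin l) R}, e • X = e • Y →
      X.map π = Y.map π := fun {k l X Y} h => by
    ext i j
    simpa [he] using congrArg π (congrFun (congrFun h i) j)
  replace h1 := hmap h1
  replace h2 := hmap h2
  replace h3 := hmap h3
  replace h4 := hmap h4
  rw [Matrix.map_mul, Matrix.map_one _ (map_zero _) (map_one _)] at h1 h2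
  rw [Matrix.map_mul, Matrix.map_mul, strongKalmanState_map, Matrix.map_add _ (map_add _),
    Matrix.map_mul] at h3
  rw [Matrix.map_mul, Matrix.map_mul, strongKalmanInput_map] at h4
  refine ⟨p, hp, brunovskiState _ p κ, brunovskiInput _ p κ, C.map π, κ,
    sysReachable_brunovski _ κ hκp, isBrunovskiForm_brunovski _ hκ hκp,
    ⟨S'.map π, S.map π, mul_eq_one_comm.1 h1, h1⟩,
    ⟨Q.map π, Q'.map π, h2, mul_eq_one_comm.1 h2⟩, K.map π, ?_, ?_⟩
  · change strongKalmanState p hp κ (C.map π) = S'.map π * _ * S.map π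
    rw [Matrix.mul_assoc, h3, ← Matrix.mul_assoc, mul_eq_one_comm.1 h1, Matrix.one_mul]
  · change strongKalmanInput _ p hp κ = S'.map π * B.map π * Q.map π
    rw [Matrix.mul_assoc, h4, ← Matrix.mul_assoc, mul_eq_one_comm.1 h1, Matrix.one_mul]

/-- every system `(A, B)` with `B ≠ 0` over a commutative von Neumann
regular ring admits a finite complete family of pairwise orthogonal idempotents
`e k` such that over each ring `R ⧸ (1 - e k)R` (canonically isomorphic to `e kR`)
the image system is feedback equivalent to a strong Kalman decomposition
`([[Â,0],[0,Ĉ]], [[B̂],[0]])` whose reachable part `(Â, B̂)` is in Brunovski form. -/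
theorem canonical_strong_kalman_decomposition
    {R : Type*} [CommRing R]
    (hreg : ∀ a : R, ∃ x : R, a ^ 2 * x = a)
    {n m : ℕ}
    (A : Matrix (Fin n) (Fin n) R) (B : Matrix (Fin n) (Fin m) R)
    (hB : B ≠ 0) :
    ∃ (K : ℕ) (e : Fin K → R),
      (∀ k, IsIdempotentElem (e k)) ∧
      (∀ k l, k ≠ l → e k * e l = 0) ∧
      (∑ k, e k = 1) ∧
      ∀ k : Fin K,
        ∃ (p : ℕ) (hp : p ≤ n)
          (Ahat : Matrix (Fin p) (Fin p) (R ⧸ Ideal.span {1 - e k}))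
          (Bhat : Matrix (Fin p) (Fin m) (R ⧸ Ideal.span {1 - e k}))
          (Chat : Matrix (Fin (n - p)) (Fin (n - p)) (R ⧸ Ideal.span {1 - e k}))
          (κ : Fin m → ℕ),
          SysReachable (R ⧸ Ideal.span {1 - e k}) Ahat Bhat ∧
          IsBrunovskiForm (R ⧸ Ideal.span {1 - e k}) Ahat Bhat κ ∧
          FeedbackEquiv (R ⧸ Ideal.span {1 - e k})
            (A.map (Ideal.Quotient.mk (Ideal.span {1 - e k})))
            (B.map (Ideal.Quotient.mk (Ideal.span {1 - e k})))
            ((Matrix.reindex (splitEquiv n p hp) (splitEquiv n p hp))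
              (Matrix.fromBlocks Ahat 0 0 Chat))
            ((Matrix.reindex (splitEquiv n p hp) (Equiv.refl (Fin m)))
              (Matrix.fromRows Bhat 0)) := by
  obtain ⟨K, e, he, hdec⟩ := exists_completeOrthogonalIdempotents (DecomposableAt A B)
    (fun _ f h => h.mul_left f) fun M _ => exists_decomposableAt_notMem hreg A B M
  exact ⟨K, e, he.idem, fun k l hkl => he.ortho hkl, he.complete, fun k => (hdec k).quotient⟩
end

section
/- Let Σ = (A,B) and Σ' = (A',B') be two reachable systems of size (n,m) over a commutative von Neumann regular ring R. Then Σ and Σ' are feedback equivalent if and only if for every k = 1,…,n the R-modules N_k^Σ and N_k^{Σ'} are isomorphic. -/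
open Matrix

namespace VonNeumannRegular

section Splitting

variable {R X Y : Type*} [CommRing R] [AddCommGroup X] [Module R X] [AddCommGroup Y] [Module R Y]

/-- A split surjection exhibits its source as the product of its kernel and its target. -/
def equivKerProd (p : X →ₗ[R] Y) (s : Y →ₗ[R] X) (h : ∀ y, p (s y) = y) :
    X ≃ₗ[R] LinearMap.ker p × Y where
  toFun x := (⟨x - s (p x), by simp [h]⟩, p x)
  invFun z := z.1 + s z.2
  map_add' x y := by
    ext <;> simp
    abel
  map_smul' r x := by
    ext <;> simp [smul_sub]
  left_inv x := by simp
  right_inv z := by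
    have hz : p (z.1 : X) = 0 := z.1.2
    ext <;> simp [h, hz]

/-- The restriction of `equivKerProd` to a submodule containing the kernel. -/
def submoduleEquivKerProd (p : X →ₗ[R] Y) (s : Y →ₗ[R] X) (h : ∀ y, p (s y) = y)
    (N : Submodule R X) (hN : LinearMap.ker p ≤ N) :
    N ≃ₗ[R] LinearMap.ker p × N.map p where
  toFun x := (⟨x - s (p x), by simp [h]⟩, ⟨p x, Submodule.mem_map_of_mem x.2⟩)
  invFun z := ⟨z.1 + s z.2, by
    obtain ⟨⟨a, ha⟩, ⟨_, x, hx, rfl⟩⟩ := z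
    have hd : x - s (p x) ∈ N := hN (by simp [h])
    have := N.add_mem (hN ha) (N.sub_mem hx hd)
    simpa using this⟩
  map_add' x y := by
    ext <;> simp
    abel
  map_smul' r x := by
    ext <;> simp [smul_sub]
  left_inv x := by simp
  right_inv z := by
    have hz : p (z.1 : X) = 0 := z.1.2
    ext <;> simp [h, hz]

theorem projective_ker_of_split [Module.Projective R X] (p : X →ₗ[R] Y) (s : Y →ₗ[R] X)
    (h : ∀ y, p (s y) = y) : Module.Projective R (LinearMap.ker p) := by
  have e := equivKerProd p s h
  refine .of_split (e.symm.toLinearMap ∘ₗ LinearMap.inl R _ _)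
    (LinearMap.fst R _ _ ∘ₗ e.toLinearMap) ?_
  ext x
  simp

end Splitting

section Projective

variable {R : Type*} [CommRing R]

/-- Every module over a von Neumann regular ring is flat. -/
theorem flat (hreg : ∀ a : R, ∃ x : R, a ^ 2 * x = a) (M : Type*) [AddCommGroup M] [Module R M] :
    Module.Flat R M := by
  rw [Module.Flat.iff_rTensor_injective]
  intro I hI
  have hII : IsIdempotentElem I := by
    refine le_antisymm Ideal.mul_le_left fun a ha => ?_
    obtain ⟨x, hx⟩ := hreg a
    rw [← hx, pow_two]
    exact Ideal.mul_mem_right _ _ (Ideal.mul_mem_mul ha ha)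
  obtain ⟨e, he, rfl⟩ := (Ideal.isIdempotentElem_iff_of_fg I hI).1 hII
  let f : R →ₗ[R] Ideal.span {e} :=
    LinearMap.toSpanSingleton R _ ⟨e, Ideal.mem_span_singleton_self e⟩
  have hf : f ∘ₗ (Ideal.span {e}).subtype = LinearMap.id := by
    ext ⟨x, hx⟩
    obtain ⟨y, rfl⟩ := Ideal.mem_span_singleton'.1 hx
    simp [f, mul_assoc, he.eq]
  refine Function.LeftInverse.injective (g := f.rTensor M) fun x => ?_
  rw [← LinearMap.comp_apply, ← LinearMap.rTensor_comp, hf, LinearMap.rTensor_id,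
    LinearMap.id_apply]

/-- A von Neumann regular ring has stable range one. -/
theorem exists_isUnit_add_mul (hreg : ∀ a : R, ∃ x : R, a ^ 2 * x = a) {a b x y : R}
    (h : a * x + b * y = 1) : ∃ t, IsUnit (a + b * t) := by
  obtain ⟨z, hz⟩ := hreg a
  refine ⟨y * (1 - a * z), .of_mul_eq_one (a * z * z + (1 - a * z)) ?_⟩
  grind

theorem cancel_self (hreg : ∀ a : R, ∃ x : R, a ^ 2 * x = a) {M N : Type*}
    [AddCommGroup M] [Module R M] [AddCommGroup N] [Module R N]
    (φ : (R × M) ≃ₗ[R] (R × N)) : Nonempty (M ≃ₗ[R] N) := by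
  set c := (φ.symm (1, 0)).2 with hc
  have key : (φ (1, 0)).1 * (φ.symm (1, 0)).1 + (φ (0, c)).1 * 1 = 1 := by
    have h1 : φ ((φ.symm (1, 0)).1 • (1, 0) + (0, c)) = (1, 0) := by
      rw [hc]
      convert φ.apply_symm_apply (1, 0)
      ext <;> simp
    rw [map_add, map_smul] at h1
    have := congrArg Prod.fst h1
    simp only [Prod.fst_add, Prod.smul_fst, smul_eq_mul] at this
    rw [mul_one, mul_comm]
    exact this
  obtain ⟨t, u, hu⟩ := exists_isUnit_add_mul hreg key
  let v : R × M := (1, t • c)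
  have hv : (φ v).1 = u := by
    have : v = (1, 0) + t • (0, c) := by ext <;> simp [v]
    rw [this, map_add, map_smul, hu]
    simp [mul_comm]
  let w : R × M := (↑u⁻¹ : R) • v
  have hw : (φ w).1 = 1 := by simp [w, hv]
  have hw1 : w.1 = (↑u⁻¹ : R) := by simp [w, v]
  let f : M →ₗ[R] N := LinearMap.snd R R N ∘ₗ
    (φ.toLinearMap ∘ₗ LinearMap.inr R R M -
      (LinearMap.toSpanSingleton R _ (φ w)) ∘ₗ LinearMap.fst R R N ∘ₗ φ.toLinearMap ∘ₗ
        LinearMap.inr R R M)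
  let g : N →ₗ[R] M := LinearMap.snd R R M ∘ₗ
    (φ.symm.toLinearMap ∘ₗ LinearMap.inr R R N -
      (LinearMap.toSpanSingleton R _ v) ∘ₗ LinearMap.fst R R M ∘ₗ φ.symm.toLinearMap ∘ₗ
        LinearMap.inr R R N)
  have hf : ∀ x, φ ((0, x) - (φ (0, x)).1 • w) = (0, f x) := by
    intro x
    rw [map_sub, map_smul]
    ext <;> simp [f, hw]
  have hg : ∀ y, φ.symm ((0, y) - (φ.symm (0, y)).1 • φ v) = (0, g y) := by
    intro y
    rw [map_sub, map_smul, φ.symm_apply_apply]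
    ext <;> simp [g, v]
  have hvw : φ v = (u : R) • φ w := by simp [w, smul_smul]
  refine ⟨LinearEquiv.ofLinearMap f g ?_ ?_⟩
  · ext y
    have h1 : φ (0, g y) = (0, y) - ((φ.symm (0, y)).1 * u) • φ w := by
      rw [← hg, φ.apply_symm_apply, hvw, smul_smul]
    have h2 : (φ (0, g y)).1 = -((φ.symm (0, y)).1 * u) := by
      rw [h1]
      simp [hw]
    have h3 := hf (g y)
    rw [map_sub, map_smul, h2, h1, neg_smul, sub_neg_eq_add, sub_add_cancel] at h3
    exact (congrArg Prod.snd h3).symm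
  · ext x
    have h1 : φ.symm (0, f x) = (0, x) - (φ (0, x)).1 • w := by
      rw [← hf, φ.symm_apply_apply]
    have h2 : (φ.symm (0, f x)).1 = -((φ (0, x)).1 * (↑u⁻¹ : R)) := by
      rw [h1]
      simp [hw1]
    have h3 := hg (f x)
    rw [map_sub, map_smul, φ.symm_apply_apply, h2, h1, neg_smul, mul_smul, sub_neg_eq_add,
      sub_add_cancel] at h3
    exact (congrArg Prod.snd h3).symm

theorem cancel_fin (hreg : ∀ a : R, ∃ x : R, a ^ 2 * x = a) {M N : Type*}
    [AddCommGroup M] [Module R M] [AddCommGroup N] [Module R N] (n : ℕ)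
    (φ : ((Fin n → R) × M) ≃ₗ[R] ((Fin n → R) × N)) : Nonempty (M ≃ₗ[R] N) := by
  induction n with
  | zero =>
    exact ⟨(LinearEquiv.uniqueProd (M₂ := Fin 0 → R)).symm ≪≫ₗ φ ≪≫ₗ LinearEquiv.uniqueProd⟩
  | succ n ih =>
    let c := Fin.consLinearEquiv R (fun _ : Fin (n + 1) => R)
    have e : ((Fin n → R) × M) ≃ₗ[R] ((Fin n → R) × N) := (cancel_self hreg
      ((LinearEquiv.prodAssoc R R (Fin n → R) M).symm ≪≫ₗ
        (c.prodCongr (.refl R M)) ≪≫ₗ φ ≪≫ₗ (c.symm.prodCongr (.refl R N)) ≪≫ₗ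
        (LinearEquiv.prodAssoc R R (Fin n → R) N))).some
    exact ih e

/-- Finitely generated projective modules over a von Neumann regular ring cancel from products. -/
theorem cancel (hreg : ∀ a : R, ∃ x : R, a ^ 2 * x = a) {P P' M N : Type*}
    [AddCommGroup P] [Module R P] [AddCommGroup P'] [Module R P']
    [AddCommGroup M] [Module R M] [AddCommGroup N] [Module R N]
    [Module.Finite R P] [Module.Projective R P]
    (e : P ≃ₗ[R] P') (φ : (P × M) ≃ₗ[R] (P' × N)) : Nonempty (M ≃ₗ[R] N) := by
  obtain ⟨n, f, hf⟩ := Module.Finite.exists_fin' R P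
  obtain ⟨s, hs⟩ := Module.projective_lifting_property f LinearMap.id hf
  let k := equivKerProd f s fun y => LinearMap.congr_fun hs y
  exact cancel_fin hreg n <|
    (k.prodCongr (.refl R M)) ≪≫ₗ (LinearEquiv.prodAssoc R _ P M) ≪≫ₗ
      ((LinearEquiv.refl R (LinearMap.ker f)).prodCongr
        (φ ≪≫ₗ (e.symm.prodCongr (.refl R N)))) ≪≫ₗ
      (LinearEquiv.prodAssoc R _ P N).symm ≪≫ₗ (k.symm.prodCongr (.refl R N))

end Projective

section Systems

universe u

variable {R : Type u} [CommRing R]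

/-- The submodule of states reachable in at most `k` steps, for a system given by linear maps. -/
def reach {X U : Type*} [AddCommGroup X] [Module R X] [AddCommGroup U] [Module R U]
    (A : X →ₗ[R] X) (B : U →ₗ[R] X) : ℕ → Submodule R X
  | 0 => ⊥
  | k + 1 => LinearMap.range B ⊔ (reach A B k).map A

theorem map_reach {X U X' U' : Type*} [AddCommGroup X] [Module R X] [AddCommGroup U] [Module R U]
    [AddCommGroup X'] [Module R X'] [AddCommGroup U'] [Module R U']
    {A : X →ₗ[R] X} {B : U →ₗ[R] X} {A' : X' →ₗ[R] X'} {B' : U' →ₗ[R] X'}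
    (P : X →ₗ[R] X') (Q : U ≃ₗ[R] U') (K : X →ₗ[R] U)
    (hA : ∀ x, P (A x + B (K x)) = A' (P x)) (hB : ∀ u, P (B u) = B' (Q u)) (k : ℕ) :
    (reach A B k).map P = reach A' B' k := by
  induction k with
  | zero => simp [reach]
  | succ k ih =>
    have hr : (LinearMap.range B).map P = LinearMap.range B' := by
      ext y
      constructor
      · rintro ⟨_, ⟨u, rfl⟩, rfl⟩
        exact ⟨Q u, (hB u).symm⟩
      · rintro ⟨u, rfl⟩
        exact ⟨B (Q.symm u), ⟨_, rfl⟩, by simp [hB]⟩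
    rw [reach, reach, Submodule.map_sup, hr, ← ih]
    apply le_antisymm <;> refine sup_le le_sup_left ?_
    · rintro _ ⟨_, ⟨x, hx, rfl⟩, rfl⟩
      have : P (A x) = B' (-Q (K x)) + A' (P x) := by
        rw [← hA, map_add, hB, map_neg]
        abel
      rw [this]
      exact Submodule.add_mem_sup ⟨_, rfl⟩ ⟨_, ⟨x, hx, rfl⟩, rfl⟩
    · rintro _ ⟨_, ⟨x, hx, rfl⟩, rfl⟩
      have : A' (P x) = B' (Q (K x)) + P (A x) := by
        rw [← hA, map_add, hB, add_comm]
      rw [this]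
      exact Submodule.add_mem_sup ⟨_, rfl⟩ ⟨_, ⟨x, hx, rfl⟩, rfl⟩

/-- The reachable modules of the system induced on a quotient by the image of the input map. -/
theorem reach_quotient {X U Y : Type*} [AddCommGroup X] [Module R X] [AddCommGroup U] [Module R U]
    [AddCommGroup Y] [Module R Y] (A : X →ₗ[R] X) (B : U →ₗ[R] X)
    (p : X →ₗ[R] Y) (s : Y →ₗ[R] X) (h : ∀ y, p (s y) = y)
    (hp : LinearMap.ker p = LinearMap.range B) (k : ℕ) :
    reach (p ∘ₗ A ∘ₗ s) (p ∘ₗ A ∘ₗ (LinearMap.ker p).subtype) k = (reach A B (k + 1)).map p := by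
  have hpB : (LinearMap.range B).map p = ⊥ := by
    rw [← hp, eq_bot_iff]
    rintro _ ⟨x, hx, rfl⟩
    exact hx
  induction k with
  | zero => simp [reach, hpB]
  | succ k ih =>
    have hk : reach A B (k + 1 + 1) = LinearMap.range B ⊔ (reach A B (k + 1)).map A := rfl
    rw [reach, ih, hk, Submodule.map_sup, hpB, bot_sup_eq]
    apply le_antisymm
    · refine sup_le ?_ ?_
      · rintro _ ⟨x, rfl⟩
        exact ⟨_, ⟨x, (le_sup_left : LinearMap.range B ≤ _) (hp ▸ x.2), rfl⟩, rfl⟩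
      · rintro _ ⟨_, ⟨x, hx, rfl⟩, rfl⟩
        refine ⟨_, ⟨s (p x), ?_, rfl⟩, rfl⟩
        have hd : x - s (p x) ∈ reach A B (k + 1) :=
          (le_sup_left : LinearMap.range B ≤ _) (hp ▸ by simp [h])
        simpa using Submodule.sub_mem _ hx hd
    · rintro _ ⟨_, ⟨x, hx, rfl⟩, rfl⟩
      have hx' : p (A x) = (p ∘ₗ A ∘ₗ (LinearMap.ker p).subtype) ⟨x - s (p x), by simp [h]⟩ +
          (p ∘ₗ A ∘ₗ s) (p x) := by simp
      rw [hx']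
      exact Submodule.add_mem_sup ⟨_, rfl⟩ ⟨_, ⟨x, hx, rfl⟩, rfl⟩

theorem exists_equiv_of_surjective (hreg : ∀ a : R, ∃ x : R, a ^ 2 * x = a)
    {U U' W W' : Type*} [AddCommGroup U] [Module R U]
    [AddCommGroup U'] [Module R U'] [AddCommGroup W] [Module R W] [AddCommGroup W'] [Module R W']
    [Module.Finite R W] [Module.Projective R W]
    (f : U →ₗ[R] W) (f' : U' →ₗ[R] W') (hf : Function.Surjective f)
    (hf' : Function.Surjective f') (g : W ≃ₗ[R] W') (e : U ≃ₗ[R] U') :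
    ∃ Q : U ≃ₗ[R] U', ∀ u, f' (Q u) = g (f u) := by
  have := Module.Projective.of_equiv g
  obtain ⟨s, hs⟩ := Module.projective_lifting_property f LinearMap.id hf
  obtain ⟨s', hs'⟩ := Module.projective_lifting_property f' LinearMap.id hf'
  let k := equivKerProd f s fun y => LinearMap.congr_fun hs y
  let k' := equivKerProd f' s' fun y => LinearMap.congr_fun hs' y
  obtain ⟨c⟩ := cancel hreg g (LinearEquiv.prodComm R _ _ ≪≫ₗ k.symm ≪≫ₗ e ≪≫ₗ k' ≪≫ₗ
    LinearEquiv.prodComm R _ _)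
  refine ⟨k ≪≫ₗ c.prodCongr g ≪≫ₗ k'.symm, fun u => ?_⟩
  have h1 : ∀ u, (k' u).2 = f' u := fun _ => rfl
  rw [← h1]
  simp [k, equivKerProd]

/-- Reachable systems with isomorphic reachable modules are feedback equivalent. -/
theorem exists_feedback_equiv (hreg : ∀ a : R, ∃ x : R, a ^ 2 * x = a) (d : ℕ)
    {X U X' U' : Type u} [AddCommGroup X] [Module R X] [AddCommGroup U] [Module R U]
    [AddCommGroup X'] [Module R X'] [AddCommGroup U'] [Module R U']
    [Module.Finite R X] [Module.Projective R X] [Module.Finite R U]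
    [Module.Finite R X'] [Module.Projective R X'] [Module.Finite R U']
    (A : X →ₗ[R] X) (B : U →ₗ[R] X) (A' : X' →ₗ[R] X') (B' : U' →ₗ[R] X')
    (hr : reach A B d = ⊤) (hr' : reach A' B' d = ⊤) (e : U ≃ₗ[R] U')
    (hN : ∀ k ≤ d, Nonempty (reach A B k ≃ₗ[R] reach A' B' k)) :
    ∃ (P : X ≃ₗ[R] X') (Q : U ≃ₗ[R] U') (K : X →ₗ[R] U),
      (∀ x, P (A x + B (K x)) = A' (P x)) ∧ ∀ u, P (B u) = B' (Q u) := by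
  induction d generalizing X U X' U' with
  | zero =>
    have : Subsingleton X := (Submodule.subsingleton_iff R).1 (subsingleton_of_bot_eq_top hr)
    have : Subsingleton X' := (Submodule.subsingleton_iff R).1 (subsingleton_of_bot_eq_top hr')
    exact ⟨0, e, 0, fun _ => Subsingleton.elim _ _, fun _ => Subsingleton.elim _ _⟩
  | succ d ih =>
    have aux : ∀ {X U : Type u} [AddCommGroup X] [Module R X] [AddCommGroup U] [Module R U]
        [Module.Finite R X] [Module.Projective R X] [Module.Finite R U] (B : U →ₗ[R] X),
        ∃ (Y : Type u) (_ : AddCommGroup Y) (_ : Module R Y) (p : X →ₗ[R] Y) (s : Y →ₗ[R] X),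
          Module.Finite R Y ∧ Module.Projective R Y ∧ (∀ y, p (s y) = y) ∧
          LinearMap.ker p = LinearMap.range B := by
      intro X U _ _ _ _ _ _ _ B
      have : Module.FinitePresentation R X := Module.finitePresentation_of_projective R X
      have : Module.FinitePresentation R (X ⧸ LinearMap.range B) :=
        Module.finitePresentation_of_surjective _ (Submodule.mkQ_surjective _)
          (by rw [Submodule.ker_mkQ]; exact Module.Finite.iff_fg.1 inferInstance)
      have := flat hreg (X ⧸ LinearMap.range B)
      have hproj : Module.Projective R (X ⧸ LinearMap.range B) :=
        Module.Flat.projective_of_finitePresentation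
      obtain ⟨s, hs⟩ := Module.projective_lifting_property (LinearMap.range B).mkQ LinearMap.id
        (Submodule.mkQ_surjective _)
      exact ⟨_, _, _, (LinearMap.range B).mkQ, s, inferInstance, hproj,
        fun y => LinearMap.congr_fun hs y, Submodule.ker_mkQ _⟩
    obtain ⟨Y, _, _, p, s, _, _, hs, hp⟩ := aux B
    obtain ⟨Y', _, _, p', s', _, _, hs', hp'⟩ := aux B'
    have := projective_ker_of_split p s hs
    have := projective_ker_of_split p' s' hs'
    have : Module.Finite R (LinearMap.ker p) := by rw [hp]; infer_instance
    have : Module.Finite R (LinearMap.ker p') := by rw [hp']; infer_instance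
    have hle : ∀ k, LinearMap.ker p ≤ reach A B (k + 1) := fun k => hp ▸ le_sup_left
    have hle' : ∀ k, LinearMap.ker p' ≤ reach A' B' (k + 1) := fun k => hp' ▸ le_sup_left
    have e1 : LinearMap.ker p ≃ₗ[R] LinearMap.ker p' := by
      have h1 : reach A B 1 = LinearMap.ker p := by simp [reach, hp]
      have h1' : reach A' B' 1 = LinearMap.ker p' := by simp [reach, hp']
      exact LinearEquiv.ofEq _ _ h1.symm ≪≫ₗ (hN 1 (by omega)).some ≪≫ₗ LinearEquiv.ofEq _ _ h1'
    have hsurj : Function.Surjective p := fun y => ⟨_, hs y⟩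
    have hsurj' : Function.Surjective p' := fun y => ⟨_, hs' y⟩
    obtain ⟨P, Q, K, hA, hB⟩ := ih (p ∘ₗ A ∘ₗ s) (p ∘ₗ A ∘ₗ (LinearMap.ker p).subtype)
      (p' ∘ₗ A' ∘ₗ s') (p' ∘ₗ A' ∘ₗ (LinearMap.ker p').subtype)
      (by rw [reach_quotient A B p s hs hp, hr, Submodule.map_top, LinearMap.range_eq_top.2 hsurj])
      (by rw [reach_quotient A' B' p' s' hs' hp', hr', Submodule.map_top,
        LinearMap.range_eq_top.2 hsurj'])
      e1
      (by
        intro k hk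
        rw [reach_quotient A B p s hs hp, reach_quotient A' B' p' s' hs' hp']
        exact cancel hreg e1 ((submoduleEquivKerProd p s hs _ (hle k)).symm ≪≫ₗ
          (hN (k + 1) (by omega)).some ≪≫ₗ submoduleEquivKerProd p' s' hs' _ (hle' k)))
    let shear : (LinearMap.ker p × Y) ≃ₗ[R] (LinearMap.ker p × Y) :=
      LinearEquiv.ofLinearMap
        ((LinearMap.fst R _ _ - K ∘ₗ LinearMap.snd R _ _).prod (LinearMap.snd R _ _))
        ((LinearMap.fst R _ _ + K ∘ₗ LinearMap.snd R _ _).prod (LinearMap.snd R _ _))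
        (by ext <;> simp) (by ext <;> simp)
    let T : X ≃ₗ[R] X' :=
      equivKerProd p s hs ≪≫ₗ shear ≪≫ₗ Q.prodCongr P ≪≫ₗ (equivKerProd p' s' hs').symm
    have hT : ∀ x, T x = Q (⟨x - s (p x), by simp [hs]⟩ - K (p x)) + s' (P (p x)) := fun x => rfl
    have hTker : ∀ x : LinearMap.ker p, T x = Q x := by
      intro x
      have hx : p (x : X) = 0 := x.2
      rw [hT]
      simp [hx]
    have hpT : ∀ x, p' (T x) = P (p x) := by
      intro x
      have h0 : ∀ z : LinearMap.ker p', p' z = 0 := fun z => z.2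
      rw [hT, map_add, h0, hs', zero_add]
    have hcomm : ∀ x, p' (T (A x)) = p' (A' (T x)) := by
      intro x
      set z : LinearMap.ker p := ⟨x - s (p x), by simp [hs]⟩ with hz
      have hx : A x = A z + A (s (p x)) := by simp [hz]
      have h1 := hA (p x)
      have h2 := hB z
      have h3 := hB (K (p x))
      simp only [LinearMap.comp_apply, Submodule.subtype_apply] at h1 h2 h3
      rw [hpT, hT, ← hz, hx]
      simp only [map_add, map_sub, Submodule.coe_sub] at h1 ⊢
      rw [h2, ← h1, h3]
      abel
    obtain ⟨Q', hQ'⟩ : ∃ Q' : U ≃ₗ[R] U', ∀ u, T (B u) = B' (Q' u) := by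
      let f : U →ₗ[R] LinearMap.ker p := B.codRestrict _ fun u => hp ▸ ⟨u, rfl⟩
      let f' : U' →ₗ[R] LinearMap.ker p' := B'.codRestrict _ fun u => hp' ▸ ⟨u, rfl⟩
      have hf : Function.Surjective f := by
        rintro ⟨x, hx⟩
        obtain ⟨u, rfl⟩ : x ∈ LinearMap.range B := hp ▸ hx
        exact ⟨u, rfl⟩
      have hf' : Function.Surjective f' := by
        rintro ⟨x, hx⟩
        obtain ⟨u, rfl⟩ : x ∈ LinearMap.range B' := hp' ▸ hx
        exact ⟨u, rfl⟩
      obtain ⟨Q', hQ'⟩ := exists_equiv_of_surjective hreg f f' hf hf' Q e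
      exact ⟨Q', fun u => (hTker (f u)).trans (congrArg Subtype.val (hQ' u)).symm⟩
    obtain ⟨L, hL⟩ := Module.projective_lifting_property B'.rangeRestrict
      ((A' ∘ₗ T.toLinearMap - T.toLinearMap ∘ₗ A).codRestrict (LinearMap.range B')
        fun x => hp' ▸ by simp [hcomm]) B'.surjective_rangeRestrict
    refine ⟨T, Q', Q'.symm.toLinearMap ∘ₗ L, fun x => ?_, hQ'⟩
    have hLx : B' (L x) = A' (T x) - T (A x) := congrArg Subtype.val (LinearMap.congr_fun hL x)
    rw [map_add, hQ']
    simp [hLx]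

end Systems

end VonNeumannRegular

open VonNeumannRegular in
theorem Nmod_eq_reach {R : Type*} [CommRing R] {n m : ℕ} (A : Matrix (Fin n) (Fin n) R)
    (B : Matrix (Fin n) (Fin m) R) (k : ℕ) :
    Nmod R A B k = reach A.mulVecLin B.mulVecLin k := by
  induction k with
  | zero => simp [Nmod, reach]
  | succ k ih =>
    rw [reach, ← ih, Nmod, Nmod, Submodule.map_span, Matrix.range_mulVecLin,
      ← Submodule.span_union]
    congr 1
    ext x
    constructor
    · rintro ⟨i, hi, j, rfl⟩
      rcases i with _ | i
      · left
        exact ⟨j, by ext; simp [Matrix.col]⟩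
      · right
        refine ⟨_, ⟨i, by omega, j, rfl⟩, ?_⟩
        rw [pow_succ', Matrix.mul_assoc]
        rfl
    · rintro (⟨j, rfl⟩ | ⟨_, ⟨i, hi, j, rfl⟩, rfl⟩)
      · exact ⟨0, by omega, j, by ext; simp [Matrix.col]⟩
      · refine ⟨i + 1, by omega, j, ?_⟩
        rw [pow_succ', Matrix.mul_assoc]
        rfl

/-- two reachable systems over a commutative von Neumann regular
ring are feedback equivalent iff the modules `N_k` are isomorphic for all
`k = 1, …, n`. -/
theorem feedbackEquiv_iff_Nmod_iso
    {R : Type*} [CommRing R]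
    (hreg : ∀ a : R, ∃ x : R, a ^ 2 * x = a)
    {n m : ℕ}
    (A A' : Matrix (Fin n) (Fin n) R) (B B' : Matrix (Fin n) (Fin m) R)
    (hreach : SysReachable R A B) (hreach' : SysReachable R A' B') :
    FeedbackEquiv R A B A' B' ↔
      ∀ k : ℕ, 1 ≤ k → k ≤ n →
        Nonempty ((Nmod R A B k) ≃ₗ[R] (Nmod R A' B' k)) := by
  simp only [SysReachable, Fintype.card_fin, Nmod_eq_reach] at *
  constructor
  · rintro ⟨P, Q, K, rfl, rfl⟩ k - -
    have hP : Function.Injective (P : Matrix (Fin n) (Fin n) R).mulVecLin := by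
      refine Function.LeftInverse.injective
        (g := ((P⁻¹ : GL (Fin n) R) : Matrix (Fin n) (Fin n) R).mulVecLin) fun x => ?_
      simp
    let Q' : (Fin m → R) ≃ₗ[R] (Fin m → R) := LinearEquiv.ofLinearMap
      ((Q⁻¹ : GL (Fin m) R) : Matrix (Fin m) (Fin m) R).mulVecLin
      (Q : Matrix (Fin m) (Fin m) R).mulVecLin
      (by rw [← Matrix.mulVecLin_mul]; simp) (by rw [← Matrix.mulVecLin_mul]; simp)
    have hmap := VonNeumannRegular.map_reach (A := A.mulVecLin) (B := B.mulVecLin)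
      (A' := ((P : Matrix (Fin n) (Fin n) R) * (A + B * K) *
        ((P⁻¹ : GL (Fin n) R) : Matrix (Fin n) (Fin n) R)).mulVecLin)
      (B' := ((P : Matrix (Fin n) (Fin n) R) * B * (Q : Matrix (Fin m) (Fin m) R)).mulVecLin)
      (P : Matrix (Fin n) (Fin n) R).mulVecLin Q' K.mulVecLin
      (fun x => by simp [Matrix.mul_assoc])
      (fun u => by simp [Q', Matrix.mul_assoc]) k
    rw [Nmod_eq_reach, Nmod_eq_reach, ← hmap]
    exact ⟨Submodule.equivMapOfInjective _ hP _⟩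
  · intro h
    obtain ⟨P, Q, K, hA, hB⟩ := VonNeumannRegular.exists_feedback_equiv hreg n
      A.mulVecLin B.mulVecLin A'.mulVecLin B'.mulVecLin hreach hreach' (.refl R _) (by
        intro k hk
        rcases Nat.eq_zero_or_pos k with rfl | hk'
        · exact ⟨LinearEquiv.refl R _⟩
        · rw [← Nmod_eq_reach, ← Nmod_eq_reach]
          exact h k hk' hk)
    let P' : GL (Fin n) R := ⟨LinearMap.toMatrix' P.toLinearMap,
      LinearMap.toMatrix' P.symm.toLinearMap, by rw [← LinearMap.toMatrix'_comp]; simp,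
      by rw [← LinearMap.toMatrix'_comp]; simp⟩
    let Q' : GL (Fin m) R := ⟨LinearMap.toMatrix' Q.symm.toLinearMap,
      LinearMap.toMatrix' Q.toLinearMap, by rw [← LinearMap.toMatrix'_comp]; simp,
      by rw [← LinearMap.toMatrix'_comp]; simp⟩
    refine ⟨P', Q', LinearMap.toMatrix' K, ?_, ?_⟩
    · have : A' * (P' : Matrix (Fin n) (Fin n) R) =
          (P' : Matrix (Fin n) (Fin n) R) * (A + B * LinearMap.toMatrix' K) := by
        refine Matrix.toLin'.injective (LinearMap.ext fun x => ?_)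
        simpa [P', Matrix.toLin'_mul] using (hA x).symm
      rw [← this, Matrix.mul_assoc, Units.mul_inv, Matrix.mul_one]
    · refine Matrix.toLin'.injective (LinearMap.ext fun u => ?_)
      simpa [P', Q', Matrix.toLin'_mul] using (hB (Q.symm u)).symm
end

section
/- Let Σ = (A,b) be a system of size (n,1), with b ≠ 0, over a commutative von Neumann regular ring R. Then there exist idempotents d_1, d_2, …, d_n of R with d_1 | d_2 | … | d_n (i.e., d_i d_{i+1} = d_{i+1}), and a matrix A* ∈ R^{n×n}, such that Σ is feedback equivalent to (Ã, B̃), where B̃ = d_1·e⁽¹⁾ ∈ R^{n×1}, Ã = S + A* with S ∈ R^{n×n} the matrix having S_{i+1,i} = d_{i+1} for i = 1,…,n−1 and all other entries zero, and A* decomposes as A* = M_0 + M_1 + … + M_{n−1}, where (setting d_0 := 1) each M_i ∈ R^{n×n} vanishes outside the lower-right (n−i)×(n−i) block and satisfies M_i = d_i(1−d_{i+1})·M_i (so in particular d_{i+1}·M_i = 0). -/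
open Matrix

namespace FeedbackEquiv

variable {n m R : Type*} [Fintype n] [DecidableEq n] [Fintype m] [DecidableEq m] [CommRing R]

theorem refl (A : Matrix n n R) (B : Matrix n m R) : FeedbackEquiv R A B A B :=
  ⟨1, 1, 0, by simp, by simp⟩

theorem trans {A A' A'' : Matrix n n R} {B B' B'' : Matrix n m R}
    (h : FeedbackEquiv R A B A' B') (h' : FeedbackEquiv R A' B' A'' B'') :
    FeedbackEquiv R A B A'' B'' := by
  obtain ⟨P, Q, K, rfl, rfl⟩ := h
  obtain ⟨P', Q', K', rfl, rfl⟩ := h'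
  refine ⟨P' * P, Q * Q', K + (Q : Matrix m m R) * K' * (P : Matrix n n R), ?_, ?_⟩
  · have hP : (P : Matrix n n R) * ((P⁻¹ : GL n R) : Matrix n n R) = 1 := P.mul_inv
    simp only [_root_.mul_inv_rev, Units.val_mul, Matrix.mul_add, Matrix.add_mul, Matrix.mul_assoc]
    rw [← Matrix.mul_assoc (P : Matrix n n R) _ ((P'⁻¹ : GL n R) : Matrix n n R), hP,
      Matrix.one_mul]
    abel
  · simp only [Units.val_mul, Matrix.mul_assoc]

/-- A change of basis of the state module is a feedback equivalence. -/
theorem conj (A : Matrix n n R) (B : Matrix n m R) (P : GL n R) :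
    FeedbackEquiv R A B ((P : Matrix n n R) * A * ((P⁻¹ : GL n R) : Matrix n n R))
      ((P : Matrix n n R) * B) :=
  ⟨P, 1, 0, by simp, by simp⟩

end FeedbackEquiv

section Glue

variable {l m n R : Type*} [CommRing R]

/-- The matrix agreeing with `X` where the idempotent `e` is `1` and with `Y` where it is `0`. -/
def Matrix.glue (e : R) (X Y : Matrix l m R) : Matrix l m R := e • X + (1 - e) • Y

variable {e : R}

theorem Matrix.glue_self (X : Matrix l m R) : glue e X X = X := by
  simp [glue, ← add_smul]

theorem Matrix.glue_add (X Y X' Y' : Matrix l m R) :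
    glue e X Y + glue e X' Y' = glue e (X + X') (Y + Y') := by
  simp only [glue, smul_add]; abel

theorem Matrix.glue_mul [Fintype m] (he : IsIdempotentElem e) (X Y : Matrix l m R)
    (X' Y' : Matrix m n R) :
    glue e X Y * glue e X' Y' = glue e (X * X') (Y * Y') := by
  simp [glue, Matrix.add_mul, Matrix.mul_add, smul_smul, he.eq, he.one_sub.eq,
    he.mul_one_sub_self, he.one_sub_mul_self]

/-- The gluing of two invertible matrices along an idempotent. -/
def Matrix.GeneralLinearGroup.glue [Fintype n] [DecidableEq n] (he : IsIdempotentElem e)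
    (P P' : GL n R) : GL n R where
  val := Matrix.glue e (P : Matrix n n R) (P' : Matrix n n R)
  inv := Matrix.glue e ((P⁻¹ : GL n R) : Matrix n n R) ((P'⁻¹ : GL n R) : Matrix n n R)
  val_inv := by
    rw [Matrix.glue_mul he, ← Units.val_mul, ← Units.val_mul]; simp [Matrix.glue_self]
  inv_val := by
    rw [Matrix.glue_mul he, ← Units.val_mul, ← Units.val_mul]; simp [Matrix.glue_self]

/-- Feedback equivalences can be glued along an idempotent. -/
theorem FeedbackEquiv.glue [Fintype n] [DecidableEq n] [Fintype m] [DecidableEq m]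
    (he : IsIdempotentElem e) {A₁ A₂ A₁' A₂' : Matrix n n R} {B₁ B₂ B₁' B₂' : Matrix n m R}
    (h₁ : FeedbackEquiv R A₁ B₁ A₁' B₁') (h₂ : FeedbackEquiv R A₂ B₂ A₂' B₂') :
    FeedbackEquiv R (Matrix.glue e A₁ A₂) (Matrix.glue e B₁ B₂)
      (Matrix.glue e A₁' A₂') (Matrix.glue e B₁' B₂') := by
  obtain ⟨P₁, Q₁, K₁, rfl, rfl⟩ := h₁
  obtain ⟨P₂, Q₂, K₂, rfl, rfl⟩ := h₂
  refine ⟨.glue he P₁ P₂, .glue he Q₁ Q₂, Matrix.glue e K₁ K₂, ?_, ?_⟩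
  · change _ = Matrix.glue e _ _ * _ * Matrix.glue e _ _
    simp only [glue_mul he, glue_add]
  · change _ = Matrix.glue e _ _ * _ * Matrix.glue e _ _
    simp only [glue_mul he]

end Glue

section Bordered

variable {R : Type*} {n : ℕ}

/-- The block matrix with corner `a`, remaining first row `r`, remaining first column `c` and
lower-right block `M`. -/
def Matrix.bordered (a : R) (r c : Fin n → R) (M : Matrix (Fin n) (Fin n) R) :
    Matrix (Fin (n + 1)) (Fin (n + 1)) R :=
  Matrix.of (Fin.cons (Fin.cons a r) fun i => Fin.cons (c i) (M i))

section Entries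

variable (a : R) (r c : Fin n → R) (M : Matrix (Fin n) (Fin n) R) (i j : Fin n)

@[simp] theorem Matrix.bordered_zero_zero : bordered a r c M 0 0 = a := rfl

@[simp] theorem Matrix.bordered_zero_succ : bordered a r c M 0 j.succ = r j := rfl

@[simp] theorem Matrix.bordered_succ_zero : bordered a r c M i.succ 0 = c i := rfl

@[simp] theorem Matrix.bordered_succ_succ : bordered a r c M i.succ j.succ = M i j := rfl

end Entries

theorem Matrix.bordered_surj (A : Matrix (Fin (n + 1)) (Fin (n + 1)) R) :
    ∃ a r c M, A = bordered a r c M :=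
  ⟨A 0 0, fun j => A 0 j.succ, fun i => A i.succ 0, Matrix.of fun i j => A i.succ j.succ, by
    ext i j; cases i using Fin.cases <;> cases j using Fin.cases <;> simp⟩

variable [CommRing R]

theorem Matrix.bordered_mul (a a' : R) (r c r' c' : Fin n → R) (M M' : Matrix (Fin n) (Fin n) R) :
    bordered a r c M * bordered a' r' c' M' =
      bordered (a * a' + r ⬝ᵥ c') (a • r' + r ᵥ* M') (a' • c + M *ᵥ c')
        (vecMulVec c r' + M * M') := by
  ext i j
  cases i using Fin.cases <;> cases j using Fin.cases <;>
    simp [Matrix.mul_apply, Fin.sum_univ_succ, dotProduct, vecMul, mulVec, vecMulVec_apply,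
      mul_comm]

theorem Matrix.bordered_one : bordered 1 0 0 (1 : Matrix (Fin n) (Fin n) R) = 1 := by
  ext i j
  cases i using Fin.cases <;> cases j using Fin.cases <;>
    simp [Matrix.one_apply, Fin.succ_ne_zero, (Fin.succ_ne_zero _).symm]

/-- An upper block triangular invertible matrix with invertible diagonal blocks. -/
def Matrix.GeneralLinearGroup.upperBordered (u : Rˣ) (r : Fin n → R) (P : GL (Fin n) R) :
    GL (Fin (n + 1)) R where
  val := bordered u r 0 P
  inv := bordered (u⁻¹ : Rˣ) (-((u⁻¹ : Rˣ) : R) • (r ᵥ* ((P⁻¹ : GL (Fin n) R) : Matrix _ _ R))) 0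
    ((P⁻¹ : GL (Fin n) R) : Matrix _ _ R)
  val_inv := by
    rw [bordered_mul, ← bordered_one]
    simp [smul_smul, -Matrix.coe_units_inv]
  inv_val := by
    rw [bordered_mul, ← bordered_one]
    simp [Matrix.neg_vecMul, Matrix.smul_vecMul, Matrix.vecMul_vecMul, -Matrix.coe_units_inv]

/-- The transvections adding multiples of the first row to the other rows. -/
def Matrix.GeneralLinearGroup.lowerBordered (c : Fin n → R) : GL (Fin (n + 1)) R where
  val := bordered 1 0 c 1
  inv := bordered 1 0 (-c) 1
  val_inv := by rw [bordered_mul, ← bordered_one]; simp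
  inv_val := by rw [bordered_mul, ← bordered_one]; simp

/-- The feedback class of a system with input vector `e⁽¹⁾` is determined by that of the
subsystem obtained by deleting the first state variable. -/
theorem FeedbackEquiv.bordered {a : R} {r c c' : Fin n → R} {M M' : Matrix (Fin n) (Fin n) R}
    (h : FeedbackEquiv R M (Matrix.of fun i (_ : Fin 1) => c i) M'
      (Matrix.of fun i (_ : Fin 1) => c' i)) :
    FeedbackEquiv R (Matrix.bordered a r c M)
      (Matrix.of fun i (_ : Fin 1) => (Pi.single 0 1 : Fin (n + 1) → R) i)
      (Matrix.bordered 0 0 c' M')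
      (Matrix.of fun i (_ : Fin 1) => (Pi.single 0 1 : Fin (n + 1) → R) i) := by
  obtain ⟨P, Q, K, rfl, hc⟩ := h
  let q : Rˣ := ⟨(Q : Matrix (Fin 1) (Fin 1) R) 0 0,
    ((Q⁻¹ : GL (Fin 1) R) : Matrix (Fin 1) (Fin 1) R) 0 0, by
    simpa [Matrix.mul_apply, -Matrix.coe_units_inv] using congrFun₂ Q.mul_inv 0 0, by
    simpa [Matrix.mul_apply, -Matrix.coe_units_inv] using congrFun₂ Q.inv_mul 0 0⟩
  have hc' : c' = (q : R) • ((P : Matrix _ _ R) *ᵥ c) := by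
    ext i
    simpa [Matrix.mul_apply, mulVec, dotProduct, q, mul_comm] using congrFun₂ hc i 0
  have hK : (Matrix.of fun i (_ : Fin 1) => c i) * K = vecMulVec c (K 0) := by
    ext i j; simp [Matrix.mul_apply, vecMulVec_apply]
  let F : Matrix (Fin 1) (Fin (n + 1)) R :=
    Matrix.of fun _ => (Fin.cons (K 0 ⬝ᵥ c - a) (K 0 ᵥ* M - r) : Fin (n + 1) → R)
  refine ⟨.upperBordered q⁻¹ (-((q⁻¹ : Rˣ) : R) • K 0) P, Q, F, ?_, ?_⟩
  · have hfb : Matrix.bordered a r c M +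
        (Matrix.of fun i (_ : Fin 1) => (Pi.single 0 1 : Fin (n + 1) → R) i) * F =
        Matrix.bordered (K 0 ⬝ᵥ c) (K 0 ᵥ* M) c M := by
      ext i j
      cases i using Fin.cases <;> cases j using Fin.cases <;>
        simp [Matrix.mul_apply, F]
    rw [hfb, hK, hc']
    change _ = Matrix.bordered _ _ _ _ * _ * Matrix.bordered _ _ _ _
    rw [bordered_mul, bordered_mul]
    simp [-Matrix.coe_units_inv, smul_smul, Matrix.mul_add, Matrix.add_mul,
      Matrix.neg_vecMul, Matrix.smul_vecMul, mul_vecMulVec, vecMulVec_mul, add_comm]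
  · ext i j
    change _ = ((Matrix.bordered _ _ _ _ * _) * _ : Matrix _ _ R) _ _
    cases i using Fin.cases <;>
      simp [Matrix.mul_apply, Fin.sum_univ_succ, Subsingleton.elim j 0]
    exact q.inv_mul.symm

end Bordered

section VonNeumannRegular

variable {R : Type*} [CommRing R]

theorem exists_unit_mul_isIdempotentElem (hreg : ∀ a : R, ∃ x : R, a ^ 2 * x = a) (a : R) :
    ∃ u : Rˣ, IsIdempotentElem (u * a) := by
  obtain ⟨x, hx⟩ := hreg a
  have h : (a * x ^ 2 + 1 - a * x) * (a + 1 - a * x) = 1 := by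
    linear_combination (2 * x - x ^ 2 - 1) * hx
  refine ⟨⟨a * x ^ 2 + 1 - a * x, a + 1 - a * x, h, by rw [mul_comm, h]⟩, ?_⟩
  have h' : (a * x ^ 2 + 1 - a * x) * a = a * x := by linear_combination (x - 1) * hx
  change _ * _ = _
  dsimp only
  rw [h']
  linear_combination x * hx

/-- The ideal generated by the entries of a vector is generated by an idempotent. -/
theorem exists_dotProduct_isIdempotentElem (hreg : ∀ a : R, ∃ x : R, a ^ 2 * x = a) {n : ℕ}
    (b : Fin n → R) : ∃ c : Fin n → R, IsIdempotentElem (c ⬝ᵥ b) ∧ (c ⬝ᵥ b) • b = b := by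
  induction n with
  | zero => exact ⟨0, by simp [IsIdempotentElem], Subsingleton.elim _ _⟩
  | succ n ih =>
    obtain ⟨c, hc, hcb⟩ := ih (Fin.tail b)
    obtain ⟨x, hx⟩ := hreg (b 0)
    generalize hh : c ⬝ᵥ Fin.tail b = h at hc hcb
    have key : (Fin.cons x ((1 - b 0 * x) • c) : Fin (n + 1) → R) ⬝ᵥ b =
        b 0 * x + (1 - b 0 * x) * h := by
      rw [← hh]
      simp [dotProduct, Fin.sum_univ_succ, Fin.tail, Finset.mul_sum, mul_assoc, mul_comm x]
    refine ⟨Fin.cons x ((1 - b 0 * x) • c), ?_, ?_⟩ <;> rw [key]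
    · have hd : IsIdempotentElem (b 0 * x) := by
        change _ * _ = _
        linear_combination x * hx
      have := hc.eq
      have := hd.eq
      change _ * _ = _
      grind
    · ext i
      cases i using Fin.cases with
      | zero =>
        simp only [Pi.smul_apply, smul_eq_mul]
        linear_combination (1 - h) * hx
      | succ i =>
        have := congrFun hcb i
        simp only [Pi.smul_apply, smul_eq_mul, Fin.tail] at this ⊢
        linear_combination (1 - b 0 * x) * this

theorem exists_generalLinearGroup_mulVec_eq_single (hreg : ∀ a : R, ∃ x : R, a ^ 2 * x = a) {n : ℕ}
    (b : Fin (n + 1) → R) :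
    ∃ (P : GL (Fin (n + 1)) R) (d : R), IsIdempotentElem d ∧
      (P : Matrix (Fin (n + 1)) (Fin (n + 1)) R) *ᵥ b = Pi.single 0 d := by
  obtain ⟨c, hc, hcb⟩ := exists_dotProduct_isIdempotentElem hreg (Fin.tail b)
  obtain ⟨u, hu⟩ := exists_unit_mul_isIdempotentElem hreg (b 0)
  generalize hh : c ⬝ᵥ Fin.tail b = h at hc hcb
  generalize hd : u * b 0 = d at hu
  refine ⟨.lowerBordered (-Fin.tail b) * .upperBordered u ((1 - d) • c) 1, d + (1 - d) * h, ?_, ?_⟩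
  · have := hc.eq
    have := hu.eq
    change _ * _ = _
    grind
  · have h0 : u * b 0 + ∑ i, (1 - d) * c i * b i.succ = d + (1 - d) * h := by
      rw [hd, ← hh]
      simp [dotProduct, Fin.tail, Finset.mul_sum, mul_assoc]
    change (bordered _ _ _ _ * bordered _ _ _ _) *ᵥ b = _
    rw [← Matrix.mulVec_mulVec]
    have h1 : bordered (u : R) ((1 - d) • c) 0 (1 : Matrix (Fin n) (Fin n) R) *ᵥ b =
        Fin.cons (d + (1 - d) * h) (Fin.tail b) := by
      ext i
      cases i using Fin.cases with
      | zero => simpa [mulVec, dotProduct, Fin.sum_univ_succ] using h0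
      | succ i => simp [mulVec, dotProduct, Fin.sum_univ_succ, Matrix.one_apply, Fin.tail]
    rw [Units.val_one, h1]
    ext i
    cases i using Fin.cases with
    | zero => simp [mulVec, dotProduct, Fin.sum_univ_succ]
    | succ i =>
      have := congrFun hcb i
      simp only [Pi.smul_apply, smul_eq_mul] at this
      simp [mulVec, dotProduct, Fin.sum_univ_succ, Matrix.one_apply]
      linear_combination (d - 1) * this

end VonNeumannRegular

/-- every single-input system `(A, b)` with `b ≠ 0` over a
commutative von Neumann regular ring is feedback equivalent to a canonical form
`(Ã, B̃)` where `B̃ = d₁·e⁽¹⁾`, `Ã = S + A*` with `S` the subdiagonal matrix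
`S_{i+1,i} = d_{i+1}` built from a chain of idempotents `d₁ | d₂ | ⋯ | dₙ`
(here `d` is indexed by `ℕ` with the convention `d 0 = 1`, the idempotents being
`d 1, …, d n`), and `A* = M₀ + ⋯ + M_{n-1}` where `Mᵢ` vanishes outside the
lower-right `(n-i) × (n-i)` block and satisfies `Mᵢ = dᵢ(1 - d_{i+1})·Mᵢ`. -/
theorem single_input_canonical_form
    {R : Type*} [CommRing R]
    (hreg : ∀ a : R, ∃ x : R, a ^ 2 * x = a)
    {n : ℕ}
    (A : Matrix (Fin n) (Fin n) R) (b : Matrix (Fin n) (Fin 1) R)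
    (hb : b ≠ 0) :
    ∃ (d : ℕ → R),
      d 0 = 1 ∧
      (∀ j : ℕ, 1 ≤ j → j ≤ n → IsIdempotentElem (d j)) ∧
      (∀ j : ℕ, 1 ≤ j → j < n → d j * d (j + 1) = d (j + 1)) ∧
      ∃ (M : Fin n → Matrix (Fin n) (Fin n) R),
        (∀ (i p q : Fin n), ((p : ℕ) < (i : ℕ) ∨ (q : ℕ) < (i : ℕ)) → M i p q = 0) ∧
        (∀ i : Fin n, M i = (d (i : ℕ) * (1 - d ((i : ℕ) + 1))) • M i) ∧
        FeedbackEquiv R A b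
          ((Matrix.of fun p q : Fin n =>
              if (p : ℕ) = (q : ℕ) + 1 then d ((p : ℕ) + 1) else 0) + ∑ i, M i)
          (Matrix.of fun (p : Fin n) (_ : Fin 1) =>
              if (p : ℕ) = 0 then d 1 else 0) := by
  clear hb
  induction n with
  | zero =>
    refine ⟨fun j => if j = 0 then 1 else 0, by simp, by omega, by omega, fun i => i.elim0,
      fun i => i.elim0, fun i => i.elim0, ?_⟩
    convert FeedbackEquiv.refl A b using 1 <;> exact Subsingleton.elim _ _
  | succ n ih =>
    obtain ⟨P, e, he, hP⟩ :=
      exists_generalLinearGroup_mulVec_eq_single hreg (fun i => b i 0)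
    have hPb : (P : Matrix (Fin (n + 1)) (Fin (n + 1)) R) * b =
        Matrix.of fun i (_ : Fin 1) => (Pi.single 0 e : Fin (n + 1) → R) i := by
      ext i j
      rw [Subsingleton.elim j 0]
      exact congrFun hP i
    have h₁ := FeedbackEquiv.conj A b P
    rw [hPb] at h₁
    generalize (P : Matrix (Fin (n + 1)) (Fin (n + 1)) R) * A *
      ((P⁻¹ : GL (Fin (n + 1)) R) : Matrix _ _ R) = A₁ at h₁
    obtain ⟨a, r, c, N, hA₁⟩ := Matrix.bordered_surj A₁
    obtain ⟨d, hd0, hd, hdd, M, hM0, hM, hMe⟩ := ih N (Matrix.of fun i _ => c i)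
    have h₂ := (FeedbackEquiv.bordered (a := a) (r := r)
      (c' := fun p => if (p : ℕ) = 0 then d 1 else 0) hMe).glue he (FeedbackEquiv.refl A₁ 0)
    rw [← hA₁, Matrix.glue_self] at h₂
    have hB : Matrix.glue e (Matrix.of fun i (_ : Fin 1) => (Pi.single 0 1 : Fin (n + 1) → R) i) 0 =
        (Matrix.of fun i (_ : Fin 1) => (Pi.single 0 e : Fin (n + 1) → R) i :
          Matrix (Fin (n + 1)) (Fin 1) R) := by
      ext i j
      cases i using Fin.cases <;> simp [Matrix.glue]
    rw [hB] at h₂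
    have hd_idem : ∀ j ≤ n, IsIdempotentElem (d j) := fun j hj => by
      rcases Nat.eq_zero_or_pos j with rfl | h
      · rw [hd0]; exact .one
      · exact hd j h hj
    have hd_dvd : ∀ j < n, d j * d (j + 1) = d (j + 1) := fun j hj => by
      rcases Nat.eq_zero_or_pos j with rfl | h
      · rw [hd0, one_mul]
      · exact hdd j h hj
    refine ⟨fun j => Nat.casesOn j 1 fun j => e * d j, rfl, ?_, ?_,
      Fin.cons ((1 - e) • A₁) fun i => Matrix.bordered 0 0 0 (e • M i), ?_, ?_, ?_⟩
    · rintro (_ | j) h₁ h₂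
      · omega
      · exact he.mul (hd_idem j (by omega))
    · rintro (_ | j) h₁ h₂
      · omega
      · change e * d j * (e * d (j + 1)) = e * d (j + 1)
        rw [mul_mul_mul_comm, he.eq, hd_dvd j (by omega)]
    · intro i p q hpq
      cases i using Fin.cases with
      | zero => simp at hpq
      | succ i =>
        cases p using Fin.cases <;> cases q using Fin.cases <;> simp
        rw [hM0 i _ _ (by simpa using hpq), mul_zero]
    · intro i
      cases i using Fin.cases with
      | zero => simp [smul_smul, hd0, he.one_sub.eq]
      | succ i =>
        ext p q
        cases p using Fin.cases with
        | zero => cases q using Fin.cases <;> simp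
        | succ p => ?_
        cases q using Fin.cases with
        | zero => simp
        | succ q => ?_
        simp
        have := congrFun₂ (hM i) p q
        simp only [Matrix.smul_apply, smul_eq_mul] at this
        have := he.eq
        grind
    · refine h₁.trans ?_
      convert h₂ using 1
      · rw [Fin.sum_univ_succ]
        ext p q
        cases p using Fin.cases <;> cases q using Fin.cases <;>
          simp [Matrix.glue, Matrix.sum_apply, Finset.mul_sum, mul_add]
        · split_ifs with h <;> simp [h]
        · abel
      · ext p q
        cases p using Fin.cases <;> simp [hd0]
end
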